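/- arXiv:2303.18077 — 2 statements merged into one kernel-verified Lean document; each statement's English description precedes it below -/
import Mathlib

section
/- For all integers m ≥ 1 and n ≥ 1, the number of intervals in the greedy m-Tamari poset on D_{m,n} (i.e., the number of pairs (v,w) of m-Dyck paths of size n with v ≤ w in the greedy m-Tamari order) equals ((m+2)·(m+1)^{n−1} / ((mn+1)(mn+2))) · binomial((m+1)n, n). -/
/-! Words over `Bool` encode lattice paths: `true` = up step (letter 1),
`false` = down step (letter 0). -/

/-- `w` is an `m`-Dyck word: the number of 0's is `m` times the number of 1's,
and every prefix `p` satisfies `m·|p|₁ ≥ |p|₀`.  (The empty word is allowed;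
an `m`-Dyck path of size `n` is an `m`-Dyck word with `n` letters 1.) -/
def IsDyck (m : ℕ) (w : List Bool) : Prop :=
  w.count false = m * w.count true ∧
  ∀ p : List Bool, p <+: w → p.count false ≤ m * p.count true

/-- Cover relation of the greedy `m`-Tamari order: swap a valley's down step with
the *longest* Dyck factor that follows it. -/
def GreedyCover (m : ℕ) (w w' : List Bool) : Prop :=
  ∃ u d v : List Bool, d ≠ [] ∧ IsDyck m d ∧
    w = u ++ false :: (d ++ v) ∧
    w' = u ++ d ++ false :: v ∧
    ∀ d' : List Bool, d' <+: d ++ v → IsDyck m d' → d'.length ≤ d.length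

/-- The greedy `m`-Tamari order (reflexive-transitive closure of the cover relation). -/
def GreedyLe (m : ℕ) : List Bool → List Bool → Prop :=
  Relation.ReflTransGen (GreedyCover m)

/-- Cover relation of the ordinary `m`-Tamari order: swap a valley's down step with
the *shortest nonempty* Dyck factor that follows it. -/
def OrdCover (m : ℕ) (w w' : List Bool) : Prop :=
  ∃ u d v : List Bool, d ≠ [] ∧ IsDyck m d ∧
    w = u ++ false :: (d ++ v) ∧
    w' = u ++ d ++ false :: v ∧
    ∀ d' : List Bool, d' <+: d ++ v → IsDyck m d' → d' ≠ [] → d.length ≤ d'.length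

/-- The ordinary `m`-Tamari order. -/
def OrdLe (m : ℕ) : List Bool → List Bool → Prop :=
  Relation.ReflTransGen (OrdCover m)

/-- The word `1·0^m` (a single peak), unit of the monoid `(D_m, *)`. -/
def peakWord (m : ℕ) : List Bool := true :: List.replicate m false

/-- Length of the final descent: the longest suffix of the form `0^k`. -/
def finalDescent (w : List Bool) : ℕ := (w.reverse.takeWhile (fun b => !b)).length

/-- The product `w₁ * w₂` on nonempty `m`-Dyck words: replace the rightmost peak
(the last up step together with the `m` down steps following it) of `w₁` by `w₂`. -/
def star (m : ℕ) (w₁ w₂ : List Bool) : List Bool :=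
  w₁.take (w₁.length - (finalDescent w₁ + 1)) ++ w₂ ++
    List.replicate (finalDescent w₁ - m) false

/-- Delete the last peak (the last up step and the `m` down steps following it). -/
def delPeak (m : ℕ) (w : List Bool) : List Bool :=
  w.take (w.length - (finalDescent w + 1)) ++ List.replicate (finalDescent w - m) false

/-- `D(w₀, …, w_m) = 1 (w₀ 0) (w₁ 0) ⋯ (w_{m-1} 0) w_m` : the canonical
decomposition of nonempty `m`-Dyck words (components indexed by `Fin (m+1)`). -/
def Dpath (m : ℕ) (ws : Fin (m+1) → List Bool) : List Bool :=
  true :: ((List.ofFn fun j : Fin m => ws j.castSucc ++ [false]).flatten ++ ws (Fin.last m))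

/-- Generators of the free monoid `(D_m, *)` : the words
`D(w₁,…,w_{i−1}, 1·0^m, ∅,…,∅)` with Dyck (possibly empty) components before
position `i`. -/
def IsGenerator (m : ℕ) (g : List Bool) : Prop :=
  ∃ i : Fin (m+1), ∃ ws : Fin (m+1) → List Bool,
    (∀ j, IsDyck m (ws j)) ∧ ws i = peakWord m ∧
    (∀ j : Fin (m+1), i < j → ws j = []) ∧ g = Dpath m ws

/-- A prime (no contact) nonempty `m`-Dyck word: no proper nonempty prefix `p`
satisfies `m·|p|₁ = |p|₀`. -/
def IsPrimePath (m : ℕ) (w : List Bool) : Prop :=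
  IsDyck m w ∧ w ≠ [] ∧
  ∀ p : List Bool, p <+: w → p ≠ [] → p ≠ w → p.count false ≠ m * p.count true

namespace Greedy

/-- Paths from height `h` to height `0`, staying nonnegative. -/
def VP (m : ℕ) : ℕ → List Bool → Prop
  | h, [] => h = 0
  | 0, false :: _ => False
  | h+1, false :: d => VP m h d
  | h, true :: d => VP m (h+m) d

theorem VP_iff (m : ℕ) : ∀ (d : List Bool) (h : ℕ), VP m h d ↔
    (d.count false = m * d.count true + h ∧
      ∀ p : List Bool, p <+: d → p.count false ≤ m * p.count true + h)
  | [], h => by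
      simp only [VP, List.count_nil, List.prefix_nil]
      constructor
      · rintro rfl; simp
      · rintro ⟨h1, -⟩; omega
  | false :: d, 0 => by
      simp only [VP, false_iff]
      rintro ⟨-, h2⟩
      have := h2 [false] ⟨d, rfl⟩
      simp at this
  | false :: d, h+1 => by
      simp only [VP]
      rw [VP_iff m d h]
      constructor
      · rintro ⟨h1, h2⟩
        refine ⟨by simp [h1]; omega, ?_⟩
        intro p hp
        rcases List.prefix_cons_iff.1 hp with rfl | ⟨t, rfl, ht⟩
        · simp
        · have := h2 t ht
          simp; omega
      · rintro ⟨h1, h2⟩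
        refine ⟨by simp at h1; omega, ?_⟩
        intro p hp
        have := h2 (false :: p) (by simpa using hp)
        simp at this; omega
  | true :: d, h => by
      simp only [VP]
      rw [VP_iff m d (h+m)]
      constructor
      · rintro ⟨h1, h2⟩
        refine ⟨by simp [h1, mul_add]; omega, ?_⟩
        intro p hp
        rcases List.prefix_cons_iff.1 hp with rfl | ⟨t, rfl, ht⟩
        · simp
        · have := h2 t ht
          simp [mul_add]; omega
      · rintro ⟨h1, h2⟩
        refine ⟨by simp [mul_add] at h1; omega, ?_⟩
        intro p hp
        have := h2 (true :: p) (by simpa using hp)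
        simp [mul_add] at this; omega

theorem isDyck_iff (m : ℕ) (d : List Bool) : IsDyck m d ↔ VP m 0 d := by
  rw [VP_iff]; rfl

theorem VP_append (m : ℕ) : ∀ (a b : List Bool) (h k : ℕ), VP m h a → VP m k b →
    VP m (h+k) (a ++ b)
  | [], b, h, k, h1, h2 => by
      simp only [VP] at h1; subst h1; simpa using h2
  | false :: a, b, 0, k, h1, h2 => by simp [VP] at h1
  | false :: a, b, h+1, k, h1, h2 => by
      have := VP_append m a b h k h1 h2
      rw [show h+1+k = (h+k)+1 by omega]
      exact this
  | true :: a, b, h, k, h1, h2 => by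
      have := VP_append m a b (h+m) k h1 h2
      simp only [List.cons_append, VP]
      rwa [show h+k+m = h+m+k by omega]

theorem VP_suffix (m : ℕ) : ∀ (a b : List Bool) (h : ℕ), VP m h (a ++ b) → ∃ k, VP m k b
  | [], b, h, h1 => ⟨h, h1⟩
  | false :: a, b, 0, h1 => by simp [VP] at h1
  | false :: a, b, h+1, h1 => VP_suffix m a b h h1
  | true :: a, b, h, h1 => VP_suffix m a b (h+m) h1

/-- Paths from height `h` to `0`, positive until the very end. -/
def V (m : ℕ) : ℕ → List Bool → Prop
  | h, [] => h = 0
  | 0, _ :: _ => False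
  | h+1, false :: d => V m h d
  | h+1, true :: d => V m (h+1+m) d

theorem V_iff (m : ℕ) : ∀ (d : List Bool) (h : ℕ), V m (h+1) (d ++ [false]) ↔ VP m h d
  | [], h => by simp [V, VP]
  | false :: d, 0 => by cases d <;> simp [V, VP]
  | false :: d, h+1 => by
      simp only [List.cons_append, V, VP]; exact V_iff m d h
  | true :: d, h => by
      simp only [List.cons_append, V, VP]
      rw [show h+1+m = (h+m)+1 by omega]; exact V_iff m d (h+m)

theorem V_last (m : ℕ) : ∀ (v : List Bool) (h : ℕ), V m (h+1) v → ∃ d, v = d ++ [false]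
  | [], h, hv => by simp [V] at hv
  | false :: d, 0, hv => by
      cases d with
      | nil => exact ⟨[], rfl⟩
      | cons b d => simp [V] at hv
  | false :: d, h+1, hv => by
      obtain ⟨e, rfl⟩ := V_last m d h hv
      exact ⟨false :: e, rfl⟩
  | true :: d, h, hv => by
      simp only [V] at hv
      rw [show h+1+m = (h+m)+1 by omega] at hv
      obtain ⟨e, rfl⟩ := V_last m d (h+m) hv
      exact ⟨true :: e, rfl⟩

/-- First passage decomposition. -/
theorem V_split (m : ℕ) : ∀ (v : List Bool) (h k : ℕ), V m (h+1+k) v →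
    ∃ d v2, v = d ++ false :: v2 ∧ VP m h d ∧ V m k v2
  | [], h, k, hv => by simp [V] at hv
  | false :: v, 0, k, hv => by
      rw [show 0+1+k = k+1 by omega] at hv
      exact ⟨[], v, rfl, rfl, hv⟩
  | false :: v, h+1, k, hv => by
      rw [show h+1+1+k = (h+1+k)+1 by omega] at hv
      obtain ⟨d, v2, rfl, h1, h2⟩ := V_split m v h k hv
      exact ⟨false :: d, v2, rfl, h1, h2⟩
  | true :: v, h, k, hv => by
      rw [show h+1+k = (h+k)+1 by omega] at hv
      simp only [V] at hv
      rw [show h+k+1+m = (h+m)+1+k by omega] at hv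
      obtain ⟨d, v2, rfl, h1, h2⟩ := V_split m v (h+m) k hv
      exact ⟨true :: d, v2, rfl, h1, h2⟩

/-- The letter-by-letter description of the greedy order. -/
def Rel (m : ℕ) : List ℕ → ℕ → List Bool → List Bool → Prop
  | ds, r, [], w => ds = [] ∧ w = List.replicate r false
  | [], _, _ :: _, _ => False
  | d :: ds, r, false :: v, w => Rel m ds (r+d+1) v w
  | d :: ds, r, true :: v, w => ∃ j w', j ≤ r ∧ w = List.replicate (r-j) false ++ true :: w' ∧
      Rel m (List.replicate m 0 ++ (d+j) :: ds) 0 v w'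

theorem Rel_V1 (m : ℕ) : ∀ (v : List Bool) (ds : List ℕ) (r : ℕ) (w : List Bool),
    Rel m ds r v w → V m ds.length v
  | [], ds, r, w, h => by simp only [Rel] at h; simp [V, h.1]
  | b :: v, [], r, w, h => by simp [Rel] at h
  | false :: v, d :: ds, r, w, h => by
      simp only [Rel] at h
      exact Rel_V1 m v ds _ w h
  | true :: v, d :: ds, r, w, h => by
      simp only [Rel] at h
      obtain ⟨j, w', -, -, h⟩ := h
      have := Rel_V1 m v _ _ w' h
      simp only [List.length_append, List.length_replicate, List.length_cons] at this
      simp only [List.length_cons, V]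
      rwa [show ds.length + 1 + m = m + (ds.length + 1) by omega]

theorem V_replicate (m : ℕ) (w : List Bool) (h : ℕ) : ∀ a : ℕ,
    V m (h+a) (List.replicate a false ++ w) ↔ V m h w
  | 0 => by simp
  | a+1 => by
      rw [List.replicate_succ, List.cons_append, ← add_assoc]
      exact V_replicate m w h a

theorem Rel_V2 (m : ℕ) : ∀ (v : List Bool) (ds : List ℕ) (r : ℕ) (w : List Bool),
    Rel m ds r v w → V m (r + ds.sum + ds.length) w
  | [], ds, r, w, h => by
      simp only [Rel] at h; obtain ⟨rfl, rfl⟩ := h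
      have := (V_replicate m [] 0 r).2 rfl
      simpa using this
  | b :: v, [], r, w, h => by simp [Rel] at h
  | false :: v, d :: ds, r, w, h => by
      simp only [Rel] at h
      have := Rel_V2 m v ds _ w h
      simp only [List.sum_cons, List.length_cons]
      rwa [show r + (d + ds.sum) + (ds.length + 1) = r + d + 1 + ds.sum + ds.length by omega]
  | true :: v, d :: ds, r, w, h => by
      simp only [Rel] at h
      obtain ⟨j, w', hj, rfl, h⟩ := h
      have := Rel_V2 m v _ _ w' h
      simp at this
      rw [show r + (d :: ds).sum + (d :: ds).length
        = (d + j + ds.sum + ds.length + 1) + (r - j) by simp; omega, V_replicate]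
      simp only [V]
      rwa [show d + j + ds.sum + ds.length + 1 + m
        = d + j + ds.sum + (m + (ds.length + 1)) by omega]

theorem Rel_count (m : ℕ) : ∀ (v : List Bool) (ds : List ℕ) (r : ℕ) (w : List Bool),
    Rel m ds r v w → w.count true = v.count true
  | [], ds, r, w, h => by
      simp only [Rel] at h; obtain ⟨rfl, rfl⟩ := h
      simp [List.count_replicate]
  | b :: v, [], r, w, h => by simp [Rel] at h
  | false :: v, d :: ds, r, w, h => by
      simp only [Rel] at h
      simpa using Rel_count m v ds _ w h
  | true :: v, d :: ds, r, w, h => by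
      simp only [Rel] at h
      obtain ⟨j, w', hj, rfl, h⟩ := h
      have := Rel_count m v _ _ w' h
      simp [List.count_replicate, this]

theorem Rel_refl (m : ℕ) : ∀ (v : List Bool) (h r : ℕ), V m h v →
    Rel m (List.replicate h 0) r v (List.replicate r false ++ v)
  | [], h, r, hv => by simp only [V] at hv; subst hv; simp [Rel]
  | b :: v, 0, r, hv => by simp [V] at hv
  | false :: v, h+1, r, hv => by
      have := Rel_refl m v h (r+1) hv
      rw [List.replicate_succ]
      simp only [Rel]
      rw [List.replicate_succ', List.append_assoc] at this
      simpa using this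
  | true :: v, h+1, r, hv => by
      simp only [V] at hv
      have := Rel_refl m v _ 0 hv
      rw [List.replicate_succ]
      simp only [Rel]
      refine ⟨0, v, by omega, by simp, ?_⟩
      rw [show h+1+m = m + (h+1) by omega, List.replicate_add, List.replicate_succ] at this
      simpa using this

/-- Two parallel evolutions along a Dyck factor. -/
theorem Rel_par (m : ℕ) (b : ℕ) (ds : List ℕ) (v2 : List Bool) :
    ∀ (d : List Bool) (l : List ℕ) (x r : ℕ) (w : List Bool), VP m l.length d →
    (Rel m (l ++ x :: b :: ds) r (d ++ false :: false :: v2) w ↔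
      Rel m (l ++ (b+x+1) :: ds) r (d ++ false :: v2) w)
  | [], l, x, r, w, h => by
      simp only [VP, List.length_eq_zero_iff] at h; subst h
      simp only [List.nil_append, Rel]
      rw [show r + x + 1 + b + 1 = r + (b+x+1) + 1 by omega]
  | false :: d, [], x, r, w, h => by simp [VP] at h
  | false :: d, y :: l, x, r, w, h => by
      simp only [List.cons_append, Rel]
      exact Rel_par m b ds v2 d l x _ w h
  | true :: d, [], x, r, w, h => by
      simp only [List.nil_append, List.cons_append, Rel]
      have key : ∀ j w', _ := fun j w' =>
        Rel_par m b ds v2 d (List.replicate m 0) (x+j) 0 w' (by simpa [VP] using h)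
      constructor
      · rintro ⟨j, w', hj, hw, hr⟩
        refine ⟨j, w', hj, hw, ?_⟩
        rw [show b + x + 1 + j = b + (x+j) + 1 by omega]
        exact (key j w').1 hr
      · rintro ⟨j, w', hj, hw, hr⟩
        refine ⟨j, w', hj, hw, ?_⟩
        rw [show b + x + 1 + j = b + (x+j) + 1 by omega] at hr
        exact (key j w').2 hr
  | true :: d, y :: l, x, r, w, h => by
      simp only [List.cons_append, Rel]
      have key : ∀ j w', _ := fun j w' =>
        Rel_par m b ds v2 d (List.replicate m 0 ++ (y+j) :: l) x 0 w' (by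
          simp only [VP, List.length_cons] at h
          simp only [List.length_append, List.length_replicate, List.length_cons]
          rwa [show m + (l.length + 1) = l.length + 1 + m by omega])
      simp only [List.append_assoc, List.cons_append] at key
      constructor
      · rintro ⟨j, w', hj, hw, hr⟩
        exact ⟨j, w', hj, hw, (key j w').1 hr⟩
      · rintro ⟨j, w', hj, hw, hr⟩
        exact ⟨j, w', hj, hw, (key j w').2 hr⟩

/-- Lowering the lower path keeps the relation. -/
theorem Rel_down (m : ℕ) (d v2 : List Bool) (hd : VP m m d) :
    ∀ (u : List Bool) (ds : List ℕ) (r : ℕ) (w : List Bool),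
    Rel m ds r (u ++ true :: (d ++ false :: false :: v2)) w →
    Rel m ds r (u ++ false :: true :: (d ++ false :: v2)) w
  | [], [], r, w, h => by simp [Rel] at h
  | [], [a], r, w, h => by
      exfalso
      simp only [List.nil_append, Rel] at h
      obtain ⟨j, w', hj, hw, h⟩ := h
      have h1 := Rel_V1 m _ _ _ _ h
      simp only [List.length_append, List.length_replicate, List.length_cons,
        List.length_nil] at h1
      have h3 : VP m m (d ++ false :: v2) := by
        obtain ⟨e, he⟩ := V_last m _ _ h1
        rw [he, V_iff] at h1
        have : d ++ false :: v2 = e ∨ ∃ v3, v2 = v3 ++ [false] := by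
          rcases List.eq_nil_or_concat v2 with rfl | ⟨v3, b, rfl⟩
          · left
            have := congrArg List.dropLast he
            simpa [List.dropLast_append_of_ne_nil] using this
          · right
            have := congrArg List.getLast? he
            simp [List.getLast?_append, List.getLast?_cons] at this
            exact ⟨v3, by simp [this]⟩
        rcases this with h4 | ⟨v3, rfl⟩
        · rw [h4]; exact h1
        · have : e = d ++ false :: false :: v3 := by
            have := congrArg List.dropLast he
            simp [List.dropLast_append_of_ne_nil, List.dropLast_cons_of_ne_nil] at this
            simpa using this.symm
          subst this
          rw [VP_iff] at h1 hd
          have := h1.2 (d ++ [false]) ⟨false :: v3, by simp⟩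
          simp at this
          omega
      rw [VP_iff] at h3 hd
      have := h3.2 (d ++ [false]) ⟨v2, by simp⟩
      simp at this
      omega
  | [], a :: b :: ds, r, w, h => by
      simp only [List.nil_append, Rel] at h ⊢
      obtain ⟨j, w', hj, rfl, h⟩ := h
      refine ⟨j+a+1, w', by omega, ?_, ?_⟩
      · rw [show r + a + 1 - (j+a+1) = r - j by omega]
      · have := (Rel_par m b ds v2 d (List.replicate m 0) (a+j) 0 w' (by simpa using hd)).1 h
        rwa [show b + (j+a+1) = b + (a+j) + 1 by omega]
  | c :: u, [], r, w, h => by simp [Rel] at h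
  | false :: u, a :: ds, r, w, h => by
      simp only [List.cons_append, Rel] at h ⊢
      exact Rel_down m d v2 hd u ds _ w h
  | true :: u, a :: ds, r, w, h => by
      simp only [List.cons_append, Rel] at h ⊢
      obtain ⟨j, w', hj, hw, h⟩ := h
      exact ⟨j, w', hj, hw, Rel_down m d v2 hd u _ _ w' h⟩

theorem Rel_pops (m : ℕ) (v w : List Bool) (h : ℕ) : ∀ (a r : ℕ),
    Rel m (List.replicate (h+a) 0) r (List.replicate a false ++ v) w ↔
      Rel m (List.replicate h 0) (r+a) v w
  | 0, r => by simp
  | a+1, r => by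
      rw [← add_assoc, List.replicate_succ, List.replicate_succ, List.cons_append]
      simp only [Rel]
      rw [Rel_pops m v w h a (r+0+1), show r+0+1+a = r+(a+1) by omega]

/-- Either the two paths agree, or the lower path can be raised. -/
theorem Rel_up (m : ℕ) : ∀ (v w : List Bool) (h r : ℕ),
    Rel m (List.replicate h 0) r v w →
    List.replicate r false ++ v = w ∨
    ∃ u d v2, List.replicate r false ++ v = u ++ false :: true :: (d ++ false :: v2) ∧ VP m m d ∧
      Rel m (List.replicate (h+r) 0) 0 (u ++ true :: (d ++ false :: false :: v2)) w
  | [], w, h, r, hr => by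
      simp only [Rel] at hr; left; simp [hr.2]
  | b :: v, w, 0, r, hr => by simp [Rel] at hr
  | false :: v, w, h+1, r, hr => by
      rw [List.replicate_succ] at hr
      simp only [Rel] at hr
      have := Rel_up m v w h (r+0+1) hr
      rw [show r+0+1 = r+1 by omega, List.replicate_succ', List.append_assoc,
        show h + (r+1) = h+1+r by omega] at this
      simpa using this
  | true :: v, w, h+1, r, hr => by
      have hr0 := hr
      rw [List.replicate_succ] at hr
      simp only [Rel] at hr
      obtain ⟨j, w', hj, rfl, hr⟩ := hr
      rcases Nat.eq_zero_or_pos j with rfl | hjp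
      · have hr2 : Rel m (List.replicate (m+(h+1)) 0) 0 v w' := by
          rw [List.replicate_add, List.replicate_succ]; simpa using hr
        rcases Rel_up m v w' _ 0 hr2 with h1 | ⟨u, d, v2, h1, h2, h3⟩
        · left; simp at h1; simp [h1]
        · right
          refine ⟨List.replicate r false ++ true :: u, d, v2, ?_, h2, ?_⟩
          · simp at h1; simp [h1]
          · rw [List.append_assoc, Rel_pops, List.replicate_succ]
            simp only [List.cons_append, Rel]
            refine ⟨0, w', by omega, by simp, ?_⟩
            rw [show m + (h+1) + 0 = m+(h+1) by omega, List.replicate_add,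
              List.replicate_succ] at h3
            simpa using h3
      · right
        obtain ⟨r, rfl⟩ : ∃ r', r = r'+1 := ⟨r-1, by omega⟩
        obtain ⟨j, rfl⟩ : ∃ r', j = r'+1 := ⟨j-1, by omega⟩
        have h1 := Rel_V1 m _ _ _ _ hr
        simp only [List.length_append, List.length_replicate, List.length_cons] at h1
        rw [show m + (h+1) = m + 1 + h by omega] at h1
        obtain ⟨d, v2, rfl, h2, h3⟩ := V_split m v m h h1
        refine ⟨List.replicate r false, d, v2, ?_, h2, ?_⟩
        · rw [List.replicate_succ']; simp
        · rw [show h + 1 + (r+1) = h+1+1 + r by omega, Rel_pops, List.replicate_succ,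
            List.replicate_succ]
          simp only [Rel]
          refine ⟨j, w', by omega, ?_, ?_⟩
          · rw [show r + 1 - (j+1) = 0 + r - j by omega]
          · apply (Rel_par m 0 (List.replicate h 0) v2 d (List.replicate m 0) (0+j) 0 w'
              (by simpa using h2)).2
            rw [show 0 + (0+j) + 1 = 0 + (j+1) by omega]
            exact hr

/-- binary value -/
def val : List Bool → ℕ
  | [] => 0
  | false :: v => val v
  | true :: v => 2 ^ v.length + val v

theorem val_lt : ∀ v : List Bool, val v < 2 ^ v.length
  | [] => by simp [val]
  | false :: v => by
      have := val_lt v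
      simp only [val, List.length_cons, pow_succ]; omega
  | true :: v => by
      have := val_lt v
      simp only [val, List.length_cons, pow_succ]; omega

theorem val_append (b c : List Bool) (hl : b.length = c.length) (hv : val b < val c) :
    ∀ a : List Bool, val (a ++ b) < val (a ++ c)
  | [] => hv
  | false :: a => by simpa [val] using val_append b c hl hv a
  | true :: a => by simpa [val, hl] using val_append b c hl hv a

theorem cover_of (m : ℕ) (u d v2 : List Bool) (v : List Bool)
    (hv : v ++ [false] = u ++ false :: true :: (d ++ false :: v2)) (hd : VP m m d) :
    ∃ v', v' ++ [false] = u ++ true :: (d ++ false :: false :: v2) ∧ GreedyCover m v v' := by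
  have hD : IsDyck m (true :: d) := by rw [isDyck_iff]; simpa [VP] using hd
  rcases List.eq_nil_or_concat v2 with rfl | ⟨v3, b, rfl⟩
  · have : v = u ++ false :: (true :: d ++ []) := by
      have := congrArg List.dropLast hv
      simpa [List.dropLast_append_of_ne_nil, List.dropLast_cons_of_ne_nil] using this
    refine ⟨u ++ (true :: d) ++ false :: [], by simp, u, true :: d, [], by simp, hD, this, rfl, ?_⟩
    intro d' h1 h2
    simpa using h1.length_le
  · have hb : b = false := by
      have := congrArg List.getLast? hv
      simpa [List.getLast?_append, List.getLast?_cons, eq_comm] using this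
    subst hb
    have : v = u ++ false :: (true :: d ++ false :: v3) := by
      have := congrArg List.dropLast hv
      simpa [List.dropLast_append_of_ne_nil, List.dropLast_cons_of_ne_nil] using this
    refine ⟨u ++ (true :: d) ++ false :: (false :: v3), by simp, u, true :: d, false :: v3,
      by simp, hD, this, rfl, ?_⟩
    intro d' h1 h2
    by_contra hlt
    have h3 : (true :: d) ++ [false] <+: d' := by
      apply List.prefix_of_prefix_length_le (l₃ := true :: d ++ false :: v3) _ h1
      · simp at hlt ⊢; omega
      · exact ⟨v3, by simp⟩
    have h4 := h2.2 _ h3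
    have h5 := hD.1
    simp only [List.count_append] at h4
    simp at h4 h5
    omega

theorem prefix_split {p a b : List Bool} (h : p <+: a ++ b) :
    p <+: a ∨ ∃ q, p = a ++ q ∧ q <+: b := by
  rcases List.prefix_or_prefix_of_prefix h (List.prefix_append a b) with h1 | ⟨q, rfl⟩
  · exact Or.inl h1
  · exact Or.inr ⟨q, rfl, (List.prefix_append_right_inj _).1 h⟩

theorem cover_to (m : ℕ) (v v' : List Bool) (hv : IsDyck m v) (h : GreedyCover m v v') :
    IsDyck m v' ∧ ∃ u d v2, v ++ [false] = u ++ false :: true :: (d ++ false :: v2) ∧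
      v' ++ [false] = u ++ true :: (d ++ false :: false :: v2) ∧ VP m m d := by
  obtain ⟨u, e, t, hne, he, rfl, rfl, hmax⟩ := h
  rw [isDyck_iff] at he
  constructor
  · refine ⟨?_, ?_⟩
    · have := hv.1
      simp only [List.count_append, List.count_cons] at this ⊢
      simp at this ⊢
      linarith
    · intro p hp
      rw [List.append_assoc] at hp
      rcases prefix_split hp with hp | ⟨p1, rfl, hp1⟩
      · exact hv.2 p (hp.trans ⟨_, rfl⟩)
      have h0 := hv.2 (u ++ [false]) ⟨e ++ t, by simp⟩
      have he2 := ((VP_iff m e 0).1 he)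
      rcases prefix_split hp1 with hp2 | ⟨p2, rfl, hp2⟩
      · have := he2.2 p1 hp2
        simp [mul_add] at h0 this ⊢
        omega
      rcases List.prefix_cons_iff.1 hp2 with rfl | ⟨p3, rfl, hp3⟩
      · have := he2.1
        simp [mul_add] at h0 this ⊢
        omega
      · have := hv.2 (u ++ false :: (e ++ p3)) (by
          obtain ⟨q, rfl⟩ := hp3
          exact ⟨q, by simp⟩)
        simp [mul_add] at this ⊢
        omega
  · obtain ⟨d, rfl⟩ : ∃ d, e = true :: d := by
      match e, hne, he with
      | false :: e, _, he => simp [VP] at he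
      | true :: e, _, _ => exact ⟨e, rfl⟩
    have hd : VP m m d := by simpa [VP] using he
    obtain ⟨v2, hv2⟩ : ∃ v2, t ++ [false] = false :: v2 := by
      match t, hmax, hv with
      | [], _, _ => exact ⟨[], rfl⟩
      | false :: t, _, _ => exact ⟨t ++ [false], rfl⟩
      | true :: t, hmax, hv =>
        exfalso
        rw [isDyck_iff] at hv
        obtain ⟨k, hk⟩ := VP_suffix m (u ++ false :: true :: d) (true :: t) 0 (by simpa using hv)
        rw [← V_iff, show k + 1 = 0 + 1 + k by omega] at hk
        obtain ⟨d3, v3, h1, h2, h3⟩ := V_split m _ 0 k hk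
        have hp : d3 <+: true :: t := by
          apply List.prefix_of_prefix_length_le (l₃ := true :: t ++ [false]) _ ⟨_, rfl⟩
          · have := congrArg List.length h1
            simp at this ⊢; omega
          · rw [h1]; exact ⟨_, rfl⟩
        have hne3 : d3 ≠ [] := by
          rintro rfl
          simp at h1
        have := hmax (true :: d ++ d3) ((List.prefix_append_right_inj _).2 hp) (by
          rw [isDyck_iff]; exact VP_append m _ _ 0 0 he h2)
        have h5 := List.length_pos_iff.2 hne3
        simp only [List.length_append] at this
        omega
    refine ⟨u, d, v2, ?_, ?_, hd⟩
    · simp [hv2]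
    · simp [hv2]

theorem le_to (m : ℕ) (v w : List Bool) (hv : IsDyck m v) (h : GreedyLe m v w) :
    IsDyck m w ∧ Rel m [0] 0 (v ++ [false]) (w ++ [false]) := by
  induction h using Relation.ReflTransGen.head_induction_on with
  | refl =>
    refine ⟨hv, ?_⟩
    have := Rel_refl m (w ++ [false]) 1 0 (by
      rw [← zero_add 1, V_iff, ← isDyck_iff]; exact hv)
    simpa using this
  | head h1 _ ih =>
    obtain ⟨h2, u, d, v2, h3, h4, h5⟩ := cover_to m _ _ hv h1
    obtain ⟨h6, h7⟩ := ih h2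
    refine ⟨h6, ?_⟩
    rw [h3]
    rw [h4] at h7
    exact Rel_down m d v2 h5 u _ _ _ h7

theorem to_le (m : ℕ) (w : List Bool) : ∀ (N : ℕ) (v : List Bool),
    2 ^ (v ++ [false]).length - val (v ++ [false]) ≤ N →
    Rel m [0] 0 (v ++ [false]) (w ++ [false]) → GreedyLe m v w := by
  intro N
  induction N with
  | zero =>
    intro v hN
    have := val_lt (v ++ [false])
    omega
  | succ N ih =>
    intro v hN hr
    rcases Rel_up m (v ++ [false]) (w ++ [false]) 1 0 (by simpa using hr) with h | h
    · have : v = w := by simpa using h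
      subst this
      exact Relation.ReflTransGen.refl
    · obtain ⟨u, d, v2, h1, h2, h3⟩ := h
      simp only [List.replicate_zero, List.nil_append] at h1
      obtain ⟨v', h4, h5⟩ := cover_of m u d v2 v h1 h2
      refine Relation.ReflTransGen.head h5 (ih v' ?_ ?_)
      · have hlen : (false :: true :: (d ++ false :: v2)).length =
            (true :: (d ++ false :: false :: v2)).length := by simp; omega
        have hval : val (false :: true :: (d ++ false :: v2)) <
            val (true :: (d ++ false :: false :: v2)) := by
          have := val_lt (true :: (d ++ false :: v2))
          have h8 : (true :: (d ++ false :: v2)).length = (d ++ false :: false :: v2).length := by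
            simp; omega
          rw [h8] at this
          simp only [val] at this ⊢
          omega
        have h6 := val_append _ _ hlen hval u
        have h7 : (v' ++ [false]).length = (v ++ [false]).length := by
          rw [h4, h1]; simp; omega
        rw [h7, h4]
        rw [h1] at hN ⊢
        omega
      · rw [h4]; simpa using h3

theorem main_iff (m n : ℕ) (v' w' : List Bool) :
    (Rel m [0] 0 v' w' ∧ v'.count true = n) ↔
    ∃ v w, v' = v ++ [false] ∧ w' = w ++ [false] ∧ IsDyck m v ∧ v.count true = n ∧
      IsDyck m w ∧ w.count true = n ∧ GreedyLe m v w := by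
  constructor
  · rintro ⟨h, hn⟩
    have h1 : V m (0+1) v' := by simpa using Rel_V1 m _ _ _ _ h
    have h2 : V m (0+1) w' := by simpa using Rel_V2 m _ _ _ _ h
    obtain ⟨v, rfl⟩ := V_last m _ _ h1
    obtain ⟨w, rfl⟩ := V_last m _ _ h2
    rw [V_iff, ← isDyck_iff] at h1 h2
    have h3 := Rel_count m _ _ _ _ h
    refine ⟨v, w, rfl, rfl, h1, ?_, h2, ?_, to_le m w _ v le_rfl h⟩
    · simpa using hn
    · simp at h3 hn; omega
  · rintro ⟨v, w, rfl, rfl, h1, h2, h3, h4, h5⟩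
    exact ⟨(le_to m v w h1 h5).2, by simpa using h2⟩

end Greedy
namespace Greedy

open PowerSeries

section Algebra

variable {R : Type*} [CommRing R]

/-- Shift of coefficients. -/
noncomputable def sh : R⟦X⟧ →ₗ[R] R⟦X⟧ where
  toFun f := PowerSeries.mk fun n => coeff (n+1) f
  map_add' f g := by ext n; simp
  map_smul' a f := by ext n; simp

theorem X_mul_sh (f : R⟦X⟧) : X * sh f = f - C (constantCoeff f) := by
  ext n
  cases n with
  | zero => simp
  | succ n => simp [sh, coeff_succ_X_mul, coeff_C]

/-- The operator `W`. -/
noncomputable def W (x H : R⟦X⟧) : R⟦X⟧ →ₗ[R] R⟦X⟧ :=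
  LinearMap.id + LinearMap.mulLeft R H ∘ₗ sh ∘ₗ LinearMap.mulLeft R x

theorem W_apply (x H f : R⟦X⟧) : W x H f = f + H * sh (x * f) := rfl

/-- Iterates `(x W)^k 1`. -/
noncomputable def It (x H : R⟦X⟧) : ℕ → R⟦X⟧
  | 0 => 1
  | k+1 => x * W x H (It x H k)

theorem W_pow [IsDomain R] (x H : R⟦X⟧) (hx : constantCoeff x = 1) (r : ℕ) :
    W x H (x ^ r) = x ^ r + H * sh x * ∑ j ∈ Finset.range (r+1), x ^ j := by
  rw [W_apply, mul_assoc]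
  congr 2
  apply mul_left_cancel₀ (X_ne_zero (R := R))
  rw [X_mul_sh, ← mul_assoc, X_mul_sh, hx, mul_comm]
  simp only [map_mul, map_pow, hx, one_pow, mul_one, map_one]
  rw [← pow_succ, mul_comm, ← geom_sum_mul, mul_comm]

/-- Homogeneous expressions of degree `k` in `v, w` with given leading coefficient. -/
def IsH (v w : R⟦X⟧) (k : ℕ) (E : R⟦X⟧) (l : R) : Prop :=
  ∃ f : ℕ → R, f k = l ∧ E = ∑ j ∈ Finset.range (k+1), C (f j) * v ^ (k-j) * w ^ j

theorem IsH.mul_v {v w : R⟦X⟧} {k : ℕ} {E : R⟦X⟧} {l : R} (h : IsH v w k E l) :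
    IsH v w (k+1) (v * E) 0 := by
  obtain ⟨f, hf, rfl⟩ := h
  refine ⟨fun j => if j = k+1 then 0 else f j, by simp, ?_⟩
  rw [Finset.sum_range_succ _ (k+1), Finset.mul_sum]
  simp only [if_true, map_zero, zero_mul, add_zero]
  apply Finset.sum_congr rfl
  intro j hj
  have hj := Finset.mem_range.1 hj
  rw [if_neg (by omega), show k + 1 - j = (k - j) + 1 by omega]
  ring

theorem IsH.mul_w {v w : R⟦X⟧} {k : ℕ} {E : R⟦X⟧} {l : R} (h : IsH v w k E l) :
    IsH v w (k+1) (w * E) l := by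
  obtain ⟨f, hf, rfl⟩ := h
  refine ⟨fun j => if j = 0 then 0 else f (j-1), by simp [hf], ?_⟩
  rw [Finset.mul_sum, Finset.sum_range_succ' _ (k+1)]
  simp only [if_true, map_zero, zero_mul, add_zero]
  apply Finset.sum_congr rfl
  intro j hj
  rw [if_neg (by omega), show k + 1 - (j+1) = (k - j) by omega, Nat.add_sub_cancel]
  ring

theorem IsH.add {v w : R⟦X⟧} {k : ℕ} {E E' : R⟦X⟧} {l l' : R} (h : IsH v w k E l)
    (h' : IsH v w k E' l') : IsH v w k (E + E') (l + l') := by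
  obtain ⟨f, hf, rfl⟩ := h
  obtain ⟨g, hg, rfl⟩ := h'
  refine ⟨fun j => f j + g j, by simp [hf, hg], ?_⟩
  rw [← Finset.sum_add_distrib]
  apply Finset.sum_congr rfl
  intro j hj
  rw [map_add]; ring

theorem IsH.smul {v w : R⟦X⟧} {k : ℕ} {E : R⟦X⟧} {l : R} (a : R) (h : IsH v w k E l) :
    IsH v w k (C a * E) (a * l) := by
  obtain ⟨f, hf, rfl⟩ := h
  refine ⟨fun j => a * f j, by simp [hf], ?_⟩
  rw [Finset.mul_sum]
  apply Finset.sum_congr rfl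
  intro j hj
  rw [map_mul]; ring

theorem IsH.one (v w : R⟦X⟧) : IsH v w 0 1 1 :=
  ⟨fun _ => 1, rfl, by simp⟩

theorem IsH.pow_w (v w : R⟦X⟧) : ∀ k : ℕ, IsH v w k (w ^ k) 1
  | 0 => by simpa using IsH.one v w
  | k+1 => by rw [pow_succ']; exact (IsH.pow_w v w k).mul_w

theorem IsH.pow_v (v w : R⟦X⟧) : ∀ k : ℕ, IsH v w (k+1) (v ^ (k+1)) 0
  | 0 => by simpa using (IsH.one v w).mul_v
  | k+1 => by rw [pow_succ']; exact (IsH.pow_v v w k).mul_v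

theorem IsH.congr {v w : R⟦X⟧} {k : ℕ} {E E' : R⟦X⟧} {l l' : R} (h : IsH v w k E l)
    (hE : E = E') (hl : l = l') : IsH v w k E' l' := by subst hE; subst hl; exact h

/-- right-hand side of the closed form of `v * E_k`. -/
noncomputable def rhs (z : R) (k : ℕ) : R⟦X⟧ :=
  (X + C z) ^ (k+2) + C z * (1 + X) ^ (k+2) * X ^ k
    - C z * ((1 + X) * (X + C z)) ^ (k+1) - X ^ k * ((1 + X) * (X + C z))

theorem exists_E (z : R) : ∀ k : ℕ,
    (∃ E, IsH X ((1 + X) * (X + C z)) (k+1) E (z - (k+2) * z ^ 2) ∧ X * E = rhs z (k+1)) ∧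
    (∃ E, IsH X ((1 + X) * (X + C z)) (k+2) E (z - (k+3) * z ^ 2) ∧ X * E = rhs z (k+2)) := by
  -- the inductive step
  have step : ∀ (k : ℕ) (E E' : R⟦X⟧) (l l' : R),
      IsH X ((1 + X) * (X + C z)) k E l → X * E = rhs z k →
      IsH X ((1 + X) * (X + C z)) (k+1) E' l' → X * E' = rhs z (k+1) →
      ∃ E'', IsH X ((1 + X) * (X + C z)) (k+2) E'' (l' - z ^ 2) ∧ X * E'' = rhs z (k+2) := by
    intro k E E' l l' h1 h2 h3 h4
    refine ⟨((1 + X) * (X + C z)) * E' + C (1 - z) * (X * E')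
      + C (-1) * ((1 + X) * (X + C z) * (X * E))
      + C (-z^2) * ((1 + X) * (X + C z)) ^ (k+2)
      + C (-z) * ((1 + X) * (X + C z) * X ^ (k+1)), ?_, ?_⟩
    · refine (((((h3.mul_w).add (h3.mul_v.smul _)).add (h1.mul_v.mul_w.smul _)).add
        ((IsH.pow_w _ _ (k+2)).smul _)).add ((IsH.pow_v _ _ k).mul_w.smul _)).congr rfl ?_
      ring
    · simp only [map_sub, map_neg, map_one, map_pow]
      calc _ = ((1 + X) * (X + C z) + (1 - C z) * X) * (X * E')
            - (1 + X) * (X + C z) * X * (X * E) - C z ^ 2 * X * ((1 + X) * (X + C z)) ^ (k+2)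
            - C z * ((1 + X) * (X + C z)) * X ^ (k+2) := by ring
        _ = _ := by
          rw [h2, h4]
          simp only [rhs, mul_pow]
          generalize (C z : R⟦X⟧) = z
          generalize (X : R⟦X⟧) = v
          have e1 : (v + z) ^ (k+1+2) = (v+z)^k * (v+z)^3 := by ring
          have e2 : (v + z) ^ (k+2) = (v+z)^k * (v+z)^2 := by ring
          have e3 : (v + z) ^ (k+1) = (v+z)^k * (v+z) := by ring
          have e4 : (v + z) ^ (k+1+1) = (v+z)^k * (v+z)^2 := by ring
          have e5 : (v + z) ^ (k+2+2) = (v+z)^k * (v+z)^4 := by ring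
          have e6 : (v + z) ^ (k+2+1) = (v+z)^k * (v+z)^3 := by ring
          have f1 : (1 + v) ^ (k+1+2) = (1+v)^k * (1+v)^3 := by ring
          have f2 : (1 + v) ^ (k+2) = (1+v)^k * (1+v)^2 := by ring
          have f3 : (1 + v) ^ (k+1) = (1+v)^k * (1+v) := by ring
          have f4 : (1 + v) ^ (k+1+1) = (1+v)^k * (1+v)^2 := by ring
          have f5 : (1 + v) ^ (k+2+2) = (1+v)^k * (1+v)^4 := by ring
          have f6 : (1 + v) ^ (k+2+1) = (1+v)^k * (1+v)^3 := by ring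
          have g1 : v ^ (k+1) = v ^ k * v := by ring
          have g2 : v ^ (k+2) = v ^ k * v^2 := by ring
          simp only [e1, e2, e3, e4, e5, e6, f1, f2, f3, f4, f5, f6, g1, g2]
          generalize (v+z)^k = P
          generalize (1+v)^k = U
          generalize v^k = Q
          ring
  have h0 : IsH X ((1 + X) * (X + C z)) 0 (C (-(1-z)^2) * 1) (-(1-z)^2 * 1) :=
    (IsH.one _ _).smul _
  have h0' : X * (C (-(1-z)^2) * 1) = rhs z 0 := by
    simp only [rhs, map_sub, map_neg, map_one, map_pow]; ring
  have h1 : IsH X ((1 + X) * (X + C z)) 1 (C (z - 2 * z ^ 2) * ((1 + X) * (X + C z)) ^ 1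
      + C (-(1-z)^3) * X ^ 1) (z - 2 * z ^ 2) := by
    refine (((IsH.pow_w _ _ 1).smul _).add ((IsH.pow_v _ _ 0).smul _)).congr rfl ?_
    ring
  have h1' : X * (C (z - 2 * z ^ 2) * ((1 + X) * (X + C z)) ^ 1 + C (-(1-z)^3) * X ^ 1)
      = rhs z 1 := by
    simp only [rhs, map_sub, map_neg, map_one, map_pow, map_mul, map_ofNat]; ring
  intro k
  induction k with
  | zero =>
    refine ⟨⟨_, h1.congr rfl (by push_cast; ring), h1'⟩, ?_⟩
    obtain ⟨E, hE, hE'⟩ := step 0 _ _ _ _ h0 h0' h1 h1'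
    exact ⟨E, hE.congr rfl (by push_cast; ring), hE'⟩
  | succ k ih =>
    obtain ⟨⟨E, hE, hE'⟩, ⟨F, hF, hF'⟩⟩ := ih
    refine ⟨⟨F, hF.congr rfl (by push_cast; ring), hF'⟩, ?_⟩
    obtain ⟨G, hG, hG'⟩ := step (k+1) _ _ _ _ hE hE' hF hF'
    exact ⟨G, hG.congr rfl (by push_cast; ring), hG'⟩

/-- The elements of the parametrization. -/
noncomputable def zz (m : ℕ) (t c : R) : R := t * c ^ m
noncomputable def MM (m : ℕ) (t c : R) : R⟦X⟧ :=
  C c * (1 - C (zz m t c) * ∑ i ∈ Finset.range (m+1), (1 + X) ^ i)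
noncomputable def Mi (m : ℕ) (t c : R) : R⟦X⟧ := invOfUnit (MM m t c) 1
noncomputable def xx (m : ℕ) (t c : R) : R⟦X⟧ := (1 + X) * MM m t c
noncomputable def HH (m : ℕ) (t c : R) : R⟦X⟧ :=
  C (t * c ^ (m+1)) * (1 + X) ^ m * Mi m t c ^ 2

variable {m : ℕ} {t c : R}

theorem c_inv (hc : c = 1 + (m+1) * t * c ^ (m+1)) : c * (1 - (m+1) * zz m t c) = 1 := by
  unfold zz
  have : c ^ (m+1) = c ^ m * c := by ring
  rw [this] at hc
  linear_combination hc

theorem const_MM (hc : c = 1 + (m+1) * t * c ^ (m+1)) : constantCoeff (MM m t c) = 1 := by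
  rw [← c_inv hc]
  simp [MM]
  ring

theorem const_xx (hc : c = 1 + (m+1) * t * c ^ (m+1)) : constantCoeff (xx m t c) = 1 := by
  simp [xx, const_MM hc]

theorem MM_Mi (hc : c = 1 + (m+1) * t * c ^ (m+1)) : MM m t c * Mi m t c = 1 :=
  mul_invOfUnit _ _ (by simp [const_MM hc])

theorem const_Mi (hc : c = 1 + (m+1) * t * c ^ (m+1)) : constantCoeff (Mi m t c) = 1 := by
  simp [Mi]

theorem X_MM : X * MM m t c =
    C c * (X + C (zz m t c) - C (zz m t c) * (1 + X) ^ (m+1)) := by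
  have := geom_sum_mul (1 + X : R⟦X⟧) (m+1)
  rw [add_sub_cancel_left] at this
  unfold MM
  linear_combination (- C c * C (zz m t c)) * this

/-- `N = x H` -/
noncomputable def NN (m : ℕ) (t c : R) : R⟦X⟧ :=
  C (zz m t c * c) * (1 + X) ^ (m+1) * Mi m t c

theorem xx_HH (hc : c = 1 + (m+1) * t * c ^ (m+1)) : xx m t c * HH m t c = NN m t c := by
  have h := MM_Mi hc
  unfold xx HH NN zz
  have e : t * c ^ (m+1) = t * c ^ m * c := by ring
  rw [e]
  linear_combination (C (t * c ^ m * c) * (1 + X) ^ (m+1) * Mi m t c) * h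

/-- `y = c u (v + z) = x (v + N)` -/
theorem y_eq (hc : c = 1 + (m+1) * t * c ^ (m+1)) :
    xx m t c * (X + NN m t c) = C c * ((1 + X) * (X + C (zz m t c))) := by
  have h := MM_Mi hc
  have h2 := X_MM (m := m) (t := t) (c := c)
  unfold xx NN
  rw [map_mul]
  linear_combination (1 + X) * h2 + (1+X)^(m+2) * C (zz m t c) * C c * h

theorem It_succ (hc : c = 1 + (m+1) * t * c ^ (m+1)) (f : R⟦X⟧) :
    X * (xx m t c * W (xx m t c) (HH m t c) f) =
      C c * ((1 + X) * (X + C (zz m t c))) * f - NN m t c * C (constantCoeff f) := by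
  have h1 := X_mul_sh (xx m t c * f)
  have h0 : constantCoeff (xx m t c * f) = constantCoeff f := by
    rw [map_mul, const_xx hc, one_mul]
  rw [h0] at h1
  rw [W_apply]
  linear_combination (xx m t c * HH m t c) * h1 +
    (xx m t c * f - C (constantCoeff f)) * xx_HH hc + f * y_eq hc

/-- Auxiliary sequence, `v^k t A_k`. -/
noncomputable def bb (y N : R⟦X⟧) (t : R) (p : ℕ → R) : ℕ → R⟦X⟧
  | 0 => C t
  | k+1 => y * bb y N t p k - N * C (p k) * X ^ k

theorem bb_eq (y N : R⟦X⟧) (t : R) (p : ℕ → R) : ∀ k, bb y N t p (k+1) =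
    C t * y ^ (k+1) - N * ∑ i ∈ Finset.range (k+1), C (p i) * X ^ i * y ^ (k-i)
  | 0 => by simp [bb]; ring
  | k+1 => by
      rw [bb, bb_eq y N t p k, Finset.sum_range_succ _ (k+1)]
      have : ∑ i ∈ Finset.range (k+1), C (p i) * X ^ i * y ^ (k+1-i)
        = y * ∑ i ∈ Finset.range (k+1), C (p i) * X ^ i * y ^ (k-i) := by
        rw [Finset.mul_sum]
        apply Finset.sum_congr rfl
        intro i hi
        have hi := Finset.mem_range.1 hi
        rw [show k + 1 - i = (k - i) + 1 by omega]
        ring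
      rw [this]
      simp
      ring

theorem exists_p (hm : 1 ≤ m) (hc : c = 1 + (m+1) * t * c ^ (m+1)) :
    ∃ p : ℕ → R, p 0 = t ∧ ∃ E, X * E = rhs (zz m t c) m ∧
      ∑ i ∈ Finset.range (m+1), C (p i) * X ^ i *
        (C c * ((1 + X) * (X + C (zz m t c)))) ^ (m-i) = C c * E + X ^ m := by
  obtain ⟨k, rfl⟩ : ∃ k, m = k+1 := ⟨m-1, by omega⟩
  obtain ⟨⟨E, ⟨f, hf, hE⟩, hE'⟩, -⟩ := exists_E (zz (k+1) t c) k
  have hci := c_inv hc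
  set z := zz (k+1) t c with hz
  set w : R⟦X⟧ := (1 + X) * (X + C z) with hw
  set ci := (1 - (((k+1 : ℕ) : R)+1) * z) with hcid
  refine ⟨fun i => ci ^ (k+1-i) * (c * f (k+1-i) + if i = k+1 then 1 else 0), ?_, E, hE', ?_⟩
  · simp only [Nat.sub_zero, hf]
    rw [if_neg (by omega)]
    have h1 : c ^ (k+1) * ci ^ (k+1) = 1 := by rw [← mul_pow, hci, one_pow]
    have h2 : z - (k+2) * z^2 = z * ci := by rw [hcid]; push_cast; ring
    rw [h2]
    calc _ = ci ^ (k+1) * z * (c * ci) := by ring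
      _ = t * (c ^ (k+1) * ci ^ (k+1)) := by rw [hci, hz]; unfold zz; ring
      _ = t := by rw [h1, mul_one]
  · rw [hE, Finset.mul_sum, ← Finset.sum_range_reflect]
    have : ∀ j ∈ Finset.range (k+1+1),
        C (ci ^ (k+1-(k+1+1-1-j)) * (c * f (k+1-(k+1+1-1-j)) +
          if (k+1+1-1-j) = k+1 then 1 else 0)) * X ^ (k+1+1-1-j) *
          (C c * w) ^ (k+1-(k+1+1-1-j)) =
        C c * (C (f j) * X ^ (k+1-j) * w ^ j) + if j = 0 then X ^ (k+1) else 0 := by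
      intro j hj
      have hj := Finset.mem_range.1 hj
      rw [show k+1-(k+1+1-1-j) = j by omega, show k+1+1-1-j = k+1-j by omega]
      have h1 : (C (ci ^ j) * C c ^ j : R⟦X⟧) = 1 := by
        rw [← map_pow, ← map_mul, ← mul_pow, mul_comm ci, hci, one_pow, map_one]
      rcases Nat.eq_zero_or_pos j with rfl | hjp
      · simp; ring
      · rw [if_neg (by omega), if_neg (by omega), map_mul, add_zero, add_zero, map_mul, mul_pow]
        linear_combination (C c * C (f j) * X ^ (k+1-j) * w ^ j) * h1
    rw [Finset.sum_congr rfl this, Finset.sum_add_distrib]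
    simp

theorem bb_last [IsDomain R] (hc : c = 1 + (m+1) * t * c ^ (m+1))
    (p : ℕ → R) (E : R⟦X⟧) (hE : X * E = rhs (zz m t c) m)
    (hp : ∑ i ∈ Finset.range (m+1), C (p i) * X ^ i *
        (C c * ((1 + X) * (X + C (zz m t c)))) ^ (m-i) = C c * E + X ^ m) :
    bb (C c * ((1 + X) * (X + C (zz m t c)))) (NN m t c) t p (m+1) =
      X ^ (m+1) * (NN m t c * sh (xx m t c)) := by
  rw [bb_eq, hp]
  have h1 := X_mul_sh (xx m t c)
  rw [const_xx hc, map_one] at h1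
  have h2 := MM_Mi hc
  have h3 := X_MM (m := m) (t := t) (c := c)
  apply mul_left_cancel₀ (X_ne_zero (R := R))
  have key : X * C t * (C c * ((1 + X) * (X + C (zz m t c)))) ^ (m+1) =
      NN m t c * (C c * (X * E) + X ^ (m+1) * xx m t c) := by
    have hz : (C t * C c ^ m : R⟦X⟧) = C (zz m t c) := by simp [zz]
    have : (C t * (C c * ((1 + X) * (X + C (zz m t c)))) ^ (m+1) : R⟦X⟧) =
      C (zz m t c) * C c * (1 + X) ^ (m+1) * (X + C (zz m t c)) ^ (m+1) := by
      rw [← hz, mul_pow, mul_pow]; ring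
    have h4 : X ^ (m+1) * xx m t c = X ^ m * (1 + X) * (X * MM m t c) := by
      unfold xx; ring
    have h5 : C c * (X * E) + X ^ (m+1) * xx m t c = (X * MM m t c) * (X + C (zz m t c)) ^ (m+1) := by
      rw [h4, h3, hE, rhs, mul_pow]; ring
    rw [h5, mul_assoc, this]
    unfold NN
    rw [map_mul]
    linear_combination (-X * C (zz m t c) * C c * (1 + X) ^ (m+1) * (X + C (zz m t c)) ^ (m+1)) * h2
  linear_combination key - X^(m+1) * NN m t c * h1

theorem fixed_point [IsDomain R] (hm : 1 ≤ m) (ht : t ≠ 0) (hc : c = 1 + (m+1) * t * c ^ (m+1)) :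
    C t * W (xx m t c) (HH m t c) (It (xx m t c) (HH m t c) m) = HH m t c * sh (xx m t c) := by
  obtain ⟨p, hp0, E, hE, hp⟩ := exists_p hm hc
  have hlast := bb_last hc p E hE hp
  have hc0 : c ≠ 0 := by
    rintro rfl
    simp at hc
  have hz0 : zz m t c ≠ 0 := mul_ne_zero ht (pow_ne_zero _ hc0)
  have hy := y_eq hc
  have hsucc := It_succ hc
  have hN0 : constantCoeff (X + NN m t c) = zz m t c * c := by
    simp [NN, const_Mi hc]
  have hx0 := const_xx hc
  have hxH := xx_HH hc
  set y := C c * ((1 + X) * (X + C (zz m t c))) with hydef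
  set N := NN m t c
  set x := xx m t c
  set H := HH m t c
  have hXN : ¬ (X : R⟦X⟧) ∣ X + N := by
    rw [X_dvd_iff, hN0]; exact mul_ne_zero hz0 hc0
  have hXx : ¬ (X : R⟦X⟧) ∣ x := by
    rw [X_dvd_iff, hx0]; exact one_ne_zero
  have hXp : Prime (X : R⟦X⟧) := X_prime
  have hX0 : (X : R⟦X⟧) ≠ 0 := X_ne_zero
  -- downward step
  have down : ∀ k, X ^ (k+1) ∣ bb y N t p (k+1) →
      ∃ B, bb y N t p k = X ^ k * B ∧ constantCoeff B = p k := by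
    intro k hk
    have h1 : X ^ (k+1) ∣ (X + N) * (x * bb y N t p k - C (p k) * X ^ k) := by
      have : (X + N) * (x * bb y N t p k - C (p k) * X ^ k) =
          bb y N t p (k+1) - X ^ (k+1) * C (p k) := by
        rw [bb]; linear_combination (bb y N t p k) * hy
      rw [this]
      exact dvd_sub hk (dvd_mul_right _ _)
    have h2 := hXp.pow_dvd_of_dvd_mul_left (k+1) hXN h1
    have h3 : X ^ k ∣ x * bb y N t p k := by
      have := (pow_dvd_pow X (Nat.le_succ k)).trans h2
      have := dvd_add this (Dvd.intro_left (C (p k)) rfl : X ^ k ∣ C (p k) * X ^ k)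
      simpa using this
    obtain ⟨B, hB⟩ := hXp.pow_dvd_of_dvd_mul_left k hXx h3
    refine ⟨B, hB, ?_⟩
    rw [hB] at h2
    have h4 : X ^ k * X ∣ X ^ k * (x * B - C (p k)) := by
      rw [← pow_succ]
      convert h2 using 1; ring
    have h5 := (mul_dvd_mul_iff_left (pow_ne_zero k hX0)).1 h4
    rw [X_dvd_iff] at h5
    simp [hx0] at h5
    exact sub_eq_zero.1 h5
  have all : ∀ j, j ≤ m → ∃ B, bb y N t p (m - j) = X ^ (m-j) * B ∧
      constantCoeff B = p (m-j) := by
    intro j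
    induction j with
    | zero => intro _; exact down m (by rw [hlast]; exact dvd_mul_right _ _)
    | succ j ih =>
      intro hj
      obtain ⟨B, hB, -⟩ := ih (by omega)
      apply down
      rw [show m - (j+1) + 1 = m - j by omega, hB]
      exact dvd_mul_right _ _
  have fwd : ∀ k, k ≤ m + 1 → bb y N t p k = X ^ k * (C t * It x H k) := by
    intro k
    induction k with
    | zero => intro _; simp [bb, It]
    | succ k ih =>
      intro hk
      have h1 := ih (by omega)
      obtain ⟨B, hB, hB'⟩ := all (m-k) (by omega)
      rw [show m - (m-k) = k by omega] at hB hB'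
      have h2 : B = C t * It x H k := by
        apply mul_left_cancel₀ (pow_ne_zero k hX0)
        rw [← hB, h1]
      have h3 : p k = t * constantCoeff (It x H k) := by
        rw [← hB', h2]; simp
      rw [bb, h1, h3, It, map_mul]
      linear_combination (-(X ^ k * C t)) * hsucc (It x H k)
  have h1 := fwd (m+1) le_rfl
  rw [hlast] at h1
  have h2 := mul_left_cancel₀ (pow_ne_zero _ hX0) h1
  have hx : x ≠ 0 := by
    intro h
    rw [h] at hXx
    exact hXx (dvd_zero _)
  apply mul_left_cancel₀ hx
  rw [It] at h2
  linear_combination -h2 - sh x * hxH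

end Algebra

end Greedy
namespace Greedy

open PowerSeries

/-- approximations of the series `c` -/
noncomputable def ca (m : ℕ) : ℕ → ℚ⟦X⟧
  | 0 => 1
  | k+1 => 1 + ((m : ℚ⟦X⟧) + 1) * X * ca m k ^ (m+1)

theorem ca_dvd (m : ℕ) : ∀ k, (X : ℚ⟦X⟧) ^ (k+1) ∣ ca m (k+1) - ca m k
  | 0 => by
      simp only [ca]
      exact ⟨((m : ℚ⟦X⟧) + 1), by ring⟩
  | k+1 => by
      have h := (ca_dvd m k).trans (sub_dvd_pow_sub_pow (ca m (k+1)) (ca m k) (m+1))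
      obtain ⟨g, hg⟩ := h
      refine ⟨((m : ℚ⟦X⟧) + 1) * g, ?_⟩
      have e1 : ca m (k+1+1) = 1 + ((m : ℚ⟦X⟧) + 1) * X * ca m (k+1) ^ (m+1) := rfl
      have e2 : ca m (k+1) = 1 + ((m : ℚ⟦X⟧) + 1) * X * ca m k ^ (m+1) := rfl
      linear_combination ((m : ℚ⟦X⟧) + 1) * X * hg + e1 - e2

theorem ca_dvd' (m k : ℕ) : ∀ j, (X : ℚ⟦X⟧) ^ (k+1) ∣ ca m (k+j) - ca m k
  | 0 => by simp
  | j+1 => by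
      have h := dvd_add ((pow_dvd_pow X (by omega)).trans (ca_dvd m (k+j))) (ca_dvd' m k j)
      rwa [sub_add_sub_cancel] at h

theorem exists_c (m : ℕ) : ∃ c : ℚ⟦X⟧, c = 1 + ((m : ℚ⟦X⟧) + 1) * X * c ^ (m+1) := by
  refine ⟨PowerSeries.mk fun n => coeff n (ca m n), ?_⟩
  set c : ℚ⟦X⟧ := PowerSeries.mk fun n => coeff n (ca m n) with hc
  have h : ∀ k, (X : ℚ⟦X⟧) ^ (k+1) ∣ c - ca m k := by
    intro k
    rw [X_pow_dvd_iff]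
    intro n hn
    have h1 := ca_dvd' m n (k-n)
    rw [show n + (k-n) = k by omega, X_pow_dvd_iff] at h1
    have h2 := h1 n (by omega)
    rw [map_sub] at h2 ⊢
    rw [hc, coeff_mk]
    linarith
  ext n
  have h1 := h (n+1)
  have h2 := (h n).trans (sub_dvd_pow_sub_pow c (ca m n) (m+1))
  have h3 : (X : ℚ⟦X⟧) ^ (n+1) ∣ c - (1 + ((m : ℚ⟦X⟧) + 1) * X * c ^ (m+1)) := by
    have e : c - (1 + ((m : ℚ⟦X⟧) + 1) * X * c ^ (m+1)) = (c - ca m (n+1)) -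
        (((m : ℚ⟦X⟧) + 1) * X) * (c ^ (m+1) - ca m n ^ (m+1)) := by
      rw [ca]; ring
    rw [e]
    exact dvd_sub ((pow_dvd_pow X (by omega)).trans h1) (h2.mul_left _)
  rw [X_pow_dvd_iff] at h3
  have := h3 n (by omega)
  rw [map_sub] at this
  linarith

theorem coeff_c (m : ℕ) (c : ℚ⟦X⟧) (hc : c = 1 + ((m : ℚ⟦X⟧) + 1) * X * c ^ (m+1)) :
    ∀ N k : ℕ, (((N * (m+1) + k : ℕ) : ℚ)) * coeff N (c ^ k) =
      ((m:ℚ)+1) ^ N * k * Nat.choose (N * (m+1) + k) N := by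
  have hstep : ∀ N k : ℕ, coeff (N+1) (c ^ (k+1)) = coeff (N+1) (c ^ k) +
      ((m:ℚ)+1) * coeff N (c ^ (k+m+1)) := by
    intro N k
    have e : c ^ (k+1) = c ^ k + X * (C ((m:ℚ)+1) * c ^ (k+m+1)) := by
      have : (C ((m:ℚ)+1) : ℚ⟦X⟧) = (m : ℚ⟦X⟧) + 1 := by simp
      rw [this, pow_succ]
      nth_rewrite 2 [hc]
      ring
    rw [e, map_add, coeff_succ_X_mul, coeff_C_mul]
  have hc0 : constantCoeff c = 1 := by
    rw [hc]; simp
  intro N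
  induction N with
  | zero => intro k; simp [hc0]
  | succ N ih =>
    intro k
    induction k with
    | zero => simp [coeff_one]
    | succ k ihk =>
      have h1 := ih (k+m+1)
      have h2 := hstep N k
      rw [h2]
      have eA : (N+1) * (m+1) + k = N * (m+1) + (k+m+1) := by ring
      rw [eA] at ihk
      have eB : (N+1) * (m+1) + (k+1) = N * (m+1) + (k+m+1) + 1 := by ring
      rw [eB]
      set A := N * (m+1) + (k+m+1) with hA
      have hA0 : (A : ℚ) ≠ 0 := by positivity
      have q1 : (A : ℚ) = N * (m+1) + k + m + 1 := by rw [hA]; push_cast; ring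
      have p1 : ((A+1 : ℕ).choose (N+1) : ℚ) = A.choose N + A.choose (N+1) := by
        rw [Nat.choose_succ_succ]; push_cast; ring
      have p2 : (A.choose (N+1) : ℚ) * (N+1) = A.choose N * (A - N) := by
        have := Nat.choose_succ_right_eq A N
        have hAN : N ≤ A := by rw [hA]; nlinarith
        have : ((A.choose (N+1) * (N+1) : ℕ) : ℚ) = (A.choose N * (A-N) : ℕ) := by rw [this]
        push_cast [Nat.cast_sub hAN] at this
        exact this
      rw [p1]
      apply mul_left_cancel₀ hA0
      have hN : ((N:ℚ)+1) ≠ 0 := by positivity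
      apply mul_left_cancel₀ hN
      push_cast at ihk h1 ⊢
      generalize coeff (N+1) (c^k) = a at *
      generalize coeff N (c^(k+m+1)) = b at *
      generalize (A.choose (N+1) : ℚ) = u at *
      generalize (A.choose N : ℚ) = w at *
      generalize hp : ((m:ℚ)+1)^N = P at *
      have hP : ((m:ℚ)+1)^(N+1) = P * (m+1) := by rw [pow_succ, hp]
      rw [hP] at ihk ⊢
      linear_combination ((N:ℚ)+1)*(A+1) * ihk + ((N:ℚ)+1)*(A+1)*(m+1) * h1
        + P*(m+1)*(k-A)*p2 - (A+1)*P*(m+1)*w*q1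

end Greedy
namespace Greedy

open PowerSeries

section Count

variable {R : Type*} [CommRing R]

/-- The linear functionals attached to a list of labels. -/
noncomputable def LL (x H : R⟦X⟧) : List ℕ → R⟦X⟧ →ₗ[R] R
  | [] => coeff 0
  | d :: ds => LL x H ds ∘ₗ LinearMap.mulLeft R (x ^ (d+1)) ∘ₗ W x H

theorem LL_cons (x H : R⟦X⟧) (d : ℕ) (ds : List ℕ) (f : R⟦X⟧) :
    LL x H (d :: ds) f = LL x H ds (x ^ (d+1) * W x H f) := rfl

theorem LL_replicate (x H : R⟦X⟧) (l : List ℕ) : ∀ k i : ℕ,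
    LL x H (List.replicate k 0 ++ l) (It x H i) = LL x H l (It x H (i+k))
  | 0, i => by simp
  | k+1, i => by
      rw [List.replicate_succ, List.cons_append, LL_cons, zero_add, pow_one]
      have := LL_replicate x H l k (i+1)
      rw [It] at this
      rw [this]
      congr 2; omega

theorem LL_rec [IsDomain R] (x H : R⟦X⟧) (m : ℕ) (t : R) (hx : constantCoeff x = 1)
    (hfix : C t * W x H (It x H m) = H * sh x) (d r : ℕ) (ds : List ℕ) :
    LL x H (d :: ds) (x ^ r) = LL x H ds (x ^ (r+d+1)) +
      t * ∑ j ∈ Finset.range (r+1), LL x H (List.replicate m 0 ++ (d+j) :: ds) 1 := by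
  have h1 : ∀ j, LL x H (List.replicate m 0 ++ (d+j) :: ds) 1 =
      LL x H ds (x ^ (d+j+1) * W x H (It x H m)) := by
    intro j
    have := LL_replicate x H ((d+j) :: ds) m 0
    rw [zero_add, LL_cons] at this
    exact this
  simp only [h1]
  rw [LL_cons, W_pow x H hx, ← hfix, ← map_sum]
  have h2 : ∀ f, t * LL x H ds f = LL x H ds (C t * f) := by
    intro f
    rw [← smul_eq_C_mul, map_smul, smul_eq_mul]
  rw [h2, ← map_add]
  congr 1
  rw [mul_add, Finset.mul_sum, Finset.mul_sum, Finset.mul_sum]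
  congr 1
  · ring
  · apply Finset.sum_congr rfl
    intro j hj
    ring

end Count

theorem count_rel (m : ℕ) (x H : ℚ⟦X⟧⟦X⟧) (hx : constantCoeff x = 1)
    (hfix : C (X : ℚ⟦X⟧) * W x H (It x H m) = H * sh x) : ∀ (n : ℕ) (ds : List ℕ) (r : ℕ),
    ∃ F : Finset (List Bool × List Bool),
      (∀ p, p ∈ F ↔ Rel m ds r p.1 p.2 ∧ p.1.count true = n) ∧
      (F.card : ℚ) = coeff n (LL x H ds (x ^ r)) := by
  intro n
  induction n using Nat.strong_induction_on with
  | _ n ihn =>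
  intro ds
  induction ds with
  | nil =>
    intro r
    refine ⟨if n = 0 then {([], List.replicate r false)} else ∅, ?_, ?_⟩
    · rintro ⟨v, w⟩
      cases v with
      | nil =>
        by_cases hn : n = 0
        · simp [hn, Rel]
        · simp [hn, Rel]; intro _ h; exact hn h.symm
      | cons a v =>
        by_cases hn : n = 0
        · simp [hn, Rel]
        · simp [hn, Rel]
    · have : LL x H [] (x ^ r) = 1 := by
        simp [LL, hx]
      rw [this, coeff_one]
      split_ifs <;> simp
  | cons d ds ihd =>
    intro r
    obtain ⟨F1, hF1, hc1⟩ := ihd (r+d+1)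
    let e1 : List Bool × List Bool ↪ List Bool × List Bool :=
      ⟨fun p => (false :: p.1, p.2), by rintro ⟨a, b⟩ ⟨a', b'⟩ h; simpa using h⟩
    let e2 : ℕ → List Bool × List Bool ↪ List Bool × List Bool := fun i =>
      ⟨fun p => (true :: p.1, List.replicate i false ++ true :: p.2), by
        rintro ⟨a, b⟩ ⟨a', b'⟩ h; simpa using h⟩
    have he1 : ∀ v w, e1 (v, w) = (false :: v, w) := fun _ _ => rfl
    have he2 : ∀ i v w, e2 i (v, w) = (true :: v, List.replicate i false ++ true :: w) :=
      fun _ _ _ => rfl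
    have hrec := LL_rec x H m X hx hfix d r ds
    cases n with
    | zero =>
      refine ⟨F1.map e1, ?_, ?_⟩
      · rintro ⟨v, w⟩
        simp only [Finset.mem_map, Prod.exists, hF1, he1, Prod.mk.injEq]
        constructor
        · rintro ⟨v, w, ⟨h1, h2⟩, rfl, rfl⟩
          exact ⟨h1, by simpa using h2⟩
        · rintro ⟨h1, h2⟩
          cases v with
          | nil => simp [Rel] at h1
          | cons a v =>
            cases a with
            | false => exact ⟨v, w, ⟨h1, by simpa using h2⟩, rfl, rfl⟩
            | true => simp at h2
      · rw [Finset.card_map, hc1, hrec, map_add]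
        simp
    | succ n =>
      choose F2 hF2 hc2 using fun j => ihn n (Nat.lt_succ_self n) (List.replicate m 0 ++ (d+j)::ds) 0
      refine ⟨F1.map e1 ∪ (Finset.range (r+1)).biUnion (fun j => (F2 j).map (e2 (r-j))), ?_, ?_⟩
      · rintro ⟨v, w⟩
        simp only [Finset.mem_union, Finset.mem_biUnion, Finset.mem_map, Prod.exists, hF1, hF2, he1, he2,
          Prod.mk.injEq, Finset.mem_range]
        constructor
        · rintro (⟨v, w, ⟨h1, h2⟩, rfl, rfl⟩ | ⟨j, hj, v, w, ⟨h1, h2⟩, rfl, rfl⟩)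
          · exact ⟨h1, by simpa using h2⟩
          · exact ⟨⟨j, w, by omega, rfl, h1⟩, by simpa using h2⟩
        · rintro ⟨h1, h2⟩
          cases v with
          | nil => simp [Rel] at h1
          | cons a v =>
            cases a with
            | false => exact Or.inl ⟨v, w, ⟨h1, by simpa using h2⟩, rfl, rfl⟩
            | true =>
              obtain ⟨j, w', hj, hw, h3⟩ := h1
              exact Or.inr ⟨j, by omega, v, w', ⟨h3, by simpa using h2⟩, rfl, hw.symm⟩
      · rw [Finset.card_union_of_disjoint, Finset.card_biUnion]
        · simp only [Finset.card_map]
          push_cast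
          rw [hc1, hrec, map_add, coeff_succ_X_mul, map_sum]
          simp only [hc2, pow_zero]
        · intro i hi j hj hij
          have hi := Finset.mem_range.1 hi
          have hj := Finset.mem_range.1 hj
          refine Finset.disjoint_left.2 ?_
          rintro ⟨v, w⟩ h1 h2
          simp only [Finset.mem_map, Prod.exists, he2,
            Prod.mk.injEq] at h1 h2
          obtain ⟨a, b, -, -, h3⟩ := h1
          obtain ⟨a', b', -, -, h4⟩ := h2
          have h5 := congrArg (fun l => (l.takeWhile (fun b => !b)).length) (h3.trans h4.symm)
          simp [List.takeWhile_append, List.takeWhile_replicate] at h5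
          omega
        · rw [Finset.disjoint_left]
          rintro ⟨v, w⟩ h1 h2
          simp only [Finset.mem_map, Finset.mem_biUnion, Prod.exists, he1, he2,
            Prod.mk.injEq] at h1 h2
          obtain ⟨a, b, -, h3, -⟩ := h1
          obtain ⟨_, _, a', b', -, h4, -⟩ := h2
          rw [← h3] at h4
          simp at h4

theorem LL_final (m : ℕ) (c : ℚ⟦X⟧) (hc : c = 1 + ((m : ℚ⟦X⟧) + 1) * X * c ^ (m+1)) (n : ℕ) :
    coeff (n+1) (LL (xx m X c) (HH m X c) [0] 1) =
      (1 + (m:ℚ)/2) * coeff n (c ^ (m+1)) - (m:ℚ)/2 * coeff n (c ^ (m+2)) := by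
  have h0 : constantCoeff (HH m X c) = X * c ^ (m+1) := by
    simp [HH, const_Mi hc]
  have h1 : constantCoeff (sh (xx m X c)) = 1 - C ((m:ℚ)/2) * (c - 1) := by
    have e : constantCoeff (sh (xx m X c)) = coeff 1 (xx m X c) := by
      rw [← coeff_zero_eq_constantCoeff_apply]; simp [sh]
    have hs : ∀ k, coeff 1 (∑ i ∈ Finset.range (k+1), (1 + X : ℚ⟦X⟧⟦X⟧) ^ i) =
        C ((k:ℚ) * (k+1) / 2) := by
      intro k
      induction k with
      | zero => simp [coeff_one]
      | succ k ih =>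
        have hp : ∀ k : ℕ, coeff 1 ((1 + X : ℚ⟦X⟧⟦X⟧) ^ k) = C (k : ℚ) := by
          intro k
          induction k with
          | zero => simp [coeff_one]
          | succ k ih =>
            rw [pow_succ, mul_add, mul_one, map_add, ih, coeff_succ_mul_X]
            simp
        rw [Finset.sum_range_succ, map_add, ih, hp, ← map_add]
        congr 1
        push_cast; ring
    have hM : coeff 1 (MM m X c) = - (c * zz m X c * C ((m:ℚ)*(m+1)/2)) := by
      rw [MM, coeff_C_mul, map_sub, coeff_C_mul, hs]
      simp [coeff_one]; ring
    have : coeff 1 (xx m X c) = coeff 1 (MM m X c) + constantCoeff (MM m X c) := by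
      rw [xx, add_mul, one_mul, map_add, coeff_succ_X_mul]; simp
    rw [e, this, const_MM hc, hM]
    have hC : (C ((m:ℚ)*(m+1)/2) : ℚ⟦X⟧) = C ((m:ℚ)/2) * ((m : ℚ⟦X⟧) + 1) := by
      have : ((m : ℚ⟦X⟧) + 1) = C ((m:ℚ)+1) := by simp
      rw [this, ← map_mul]; congr 1; ring
    rw [hC]
    have := c_inv hc
    linear_combination C ((m:ℚ)/2) * this
  have h2 : LL (xx m X c) (HH m X c) [0] 1 = 1 + X * c^(m+1) * (1 - C ((m:ℚ)/2) * (c - 1)) := by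
    rw [LL_cons]
    simp only [LL, coeff_zero_eq_constantCoeff, W_apply, mul_one]
    simp [const_xx hc, h0, h1]
  have h3 : LL (xx m X c) (HH m X c) [0] 1 =
      1 + X * (C (1 + (m:ℚ)/2) * c^(m+1) - C ((m:ℚ)/2) * c^(m+2)) := by
    rw [h2, map_add, map_one]; ring
  rw [h3, map_add, coeff_succ_X_mul, map_sub, coeff_C_mul, coeff_C_mul]
  simp [coeff_one]

theorem arith (m n : ℕ) (a b : ℚ)
    (ha : (((n * (m+1) + (m+1) : ℕ) : ℚ)) * a =
      ((m:ℚ)+1) ^ n * (m+1 : ℕ) * Nat.choose (n * (m+1) + (m+1)) n)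
    (hb : (((n * (m+1) + (m+2) : ℕ) : ℚ)) * b =
      ((m:ℚ)+1) ^ n * (m+2 : ℕ) * Nat.choose (n * (m+1) + (m+2)) n) :
    (1 + (m:ℚ)/2) * a - (m:ℚ)/2 * b =
    ((m + 2) * (m + 1) ^ n : ℚ) / ((m * (n+1:ℕ) + 1) * (m * (n+1:ℕ) + 2)) *
        (Nat.choose ((m + 1) * (n+1)) (n+1) : ℚ) := by
  have hA : n * (m+1) + (m+1) = (m+1) * (n+1) := by ring
  have hB : n * (m+1) + (m+2) = (m+1) * (n+1) + 1 := by ring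
  rw [hA] at ha
  rw [hB] at hb
  set A := (m+1) * (n+1) with hAd
  have qA : (A:ℚ) = (m+1)*(n+1) := by rw [hAd]; push_cast; ring
  have hnA : n ≤ A := by rw [hAd]; nlinarith
  have p1 : (A.choose (n+1) : ℚ) * (n+1) = A.choose n * (A - n) := by
    have := Nat.choose_succ_right_eq A n
    have : ((A.choose (n+1) * (n+1) : ℕ) : ℚ) = (A.choose n * (A-n) : ℕ) := by rw [this]
    push_cast [Nat.cast_sub hnA] at this
    exact this
  have p2 : ((A+1).choose n : ℚ) * (A + 1 - n) = A.choose n * (A+1) := by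
    have := Nat.choose_mul_succ_eq A n
    have : ((A.choose n * (A+1) : ℕ) : ℚ) = ((A+1).choose n * (A+1-n) : ℕ) := by rw [this]
    rw [Nat.cast_mul, Nat.cast_mul, Nat.cast_sub (by omega)] at this
    push_cast at this
    linarith
  push_cast at ha hb ⊢
  generalize (A.choose (n+1) : ℚ) = u at *
  generalize ((A+1).choose n : ℚ) = w at *
  generalize (A.choose n : ℚ) = s at *
  generalize ((m:ℚ)+1)^n = P at *
  rw [qA] at *
  have hm0 : (0:ℚ) ≤ m := by positivity
  have hn0 : (0:ℚ) ≤ n := by positivity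
  have g1 : ((m:ℚ)+1)*(n+1) - n = m*(n+1)+1 := by ring
  have g2 : ((m:ℚ)+1)*(n+1) + 1 - n = m*(n+1)+2 := by ring
  rw [g1] at p1
  rw [g2] at p2
  have hs : s = u * (n+1) / (m*(n+1)+1) := by
    rw [eq_div_iff (by positivity)]; exact p1.symm
  have hw : w = s * ((m+1)*(n+1)+1) / (m*(n+1)+2) := by
    rw [eq_div_iff (by positivity)]; exact p2
  have ha2 : a = P * s / (n+1) := by
    rw [eq_div_iff (by positivity)]
    have : (m:ℚ)+1 ≠ 0 := by positivity
    apply mul_left_cancel₀ this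
    linear_combination ha
  have hb2 : b = P * (m+2) * w / ((m+1)*(n+1)+1) := by
    rw [eq_div_iff (by positivity)]
    linear_combination hb
  rw [hb2, ha2, hw, hs]
  field_simp
  ring

theorem final (m n : ℕ) (hm : 1 ≤ m) :
    (Nat.card {p : List Bool × List Bool //
        IsDyck m p.1 ∧ p.1.count true = n+1 ∧
        IsDyck m p.2 ∧ p.2.count true = n+1 ∧
        GreedyLe m p.1 p.2} : ℚ) =
      ((m + 2) * (m + 1) ^ n : ℚ) / ((m * (n+1:ℕ) + 1) * (m * (n+1:ℕ) + 2)) *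
        (Nat.choose ((m + 1) * (n+1)) (n+1) : ℚ) := by
  obtain ⟨c, hc⟩ := exists_c m
  obtain ⟨F, hF, hcard⟩ := count_rel m (xx m X c) (HH m X c) (const_xx hc)
    (fixed_point hm X_ne_zero hc) (n+1) [0] 0
  rw [pow_zero, LL_final m c hc, arith m n _ _ (coeff_c m c hc n (m+1)) (coeff_c m c hc n (m+2))] at hcard
  rw [← hcard]
  congr 1
  rw [← Nat.card_eq_finsetCard]
  refine Nat.card_congr (Equiv.ofBijective (fun p => ⟨(p.1.1 ++ [false], p.1.2 ++ [false]), ?_⟩) ⟨?_, ?_⟩)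
  · obtain ⟨⟨v, w⟩, h1, h2, h3, h4, h5⟩ := p
    rw [hF]
    exact (main_iff m (n+1) _ _).2 ⟨v, w, rfl, rfl, h1, h2, h3, h4, h5⟩
  · rintro ⟨⟨v, w⟩, _⟩ ⟨⟨v', w'⟩, _⟩ h
    simpa using h
  · rintro ⟨⟨v', w'⟩, h⟩
    obtain ⟨v, w, rfl, rfl, h1, h2, h3, h4, h5⟩ := (main_iff m (n+1) _ _).1 ((hF _).1 h)
    exact ⟨⟨(v, w), h1, h2, h3, h4, h5⟩, rfl⟩

end Greedy

/-- For `m ≥ 1` and `n ≥ 1`, the number of intervals of the greedy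
`m`-Tamari poset on `D_{m,n}` equals
`(m+2)(m+1)^{n-1} / ((mn+1)(mn+2)) · binom((m+1)n, n)`. -/
theorem greedy_interval_count (m n : ℕ) (hm : 1 ≤ m) (hn : 1 ≤ n) :
    (Nat.card {p : List Bool × List Bool //
        IsDyck m p.1 ∧ p.1.count true = n ∧
        IsDyck m p.2 ∧ p.2.count true = n ∧
        GreedyLe m p.1 p.2} : ℚ) =
      ((m + 2) * (m + 1) ^ (n - 1) : ℚ) / ((m * n + 1) * (m * n + 2)) *
        (Nat.choose ((m + 1) * n) n : ℚ) := by
  obtain ⟨k, rfl⟩ : ∃ k, n = k + 1 := ⟨n - 1, by omega⟩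
  exact Greedy.final m k hm
end

section
/- For all integers m ≥ 1 and n ≥ 1, the number of intervals in the ordinary m-Tamari poset on D_{m,n} (i.e., the number of pairs (v,w) of m-Dyck paths of size n with v ≤ w in the ordinary m-Tamari order) equals ((m+1) / (n(mn+1))) · binomial((m+1)²·n + m, n−1). -/
namespace TamariCount

/-- Height of a word. -/
def ht (m : ℕ) : List Bool → ℤ
  | [] => 0
  | true :: w => m + ht m w
  | false :: w => ht m w - 1

/-- All suffixes have nonpositive height. -/
def Sfx (m : ℕ) : List Bool → Prop
  | [] => True
  | x :: w => ht m (x :: w) ≤ 0 ∧ Sfx m w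

/-- Number of suffixes of height zero. -/
def con (m : ℕ) : List Bool → ℕ
  | [] => 1
  | x :: w => con m w + if ht m (x :: w) = 0 then 1 else 0

variable {m : ℕ}

@[simp] lemma ht_nil : ht m [] = 0 := rfl
@[simp] lemma ht_true (w) : ht m (true :: w) = m + ht m w := rfl
@[simp] lemma ht_false (w) : ht m (false :: w) = ht m w - 1 := rfl

@[simp] lemma ht_append (a b : List Bool) : ht m (a ++ b) = ht m a + ht m b := by
  induction a with
  | nil => simp
  | cons x a ih => cases x <;> simp [ih] <;> ring

lemma ht_eq (w : List Bool) : ht m w = m * (w.count true : ℤ) - w.count false := by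
  induction w with
  | nil => simp
  | cons x a ih => cases x <;> simp [ih] <;> ring

lemma Sfx.ht_le {w : List Bool} (h : Sfx m w) : ht m w ≤ 0 := by
  cases w with
  | nil => simp
  | cons x w => exact h.1

lemma Sfx.right {a b : List Bool} (h : Sfx m (a ++ b)) : Sfx m b := by
  induction a with
  | nil => simpa using h
  | cons x a ih => exact ih h.2

lemma Sfx.append {a b : List Bool} (ha : Sfx m a) (hb : Sfx m b) : Sfx m (a ++ b) := by
  induction a with
  | nil => simpa using hb
  | cons x a ih =>
    refine ⟨?_, ih ha.2⟩
    have h1 := ha.ht_le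
    have h2 := hb.ht_le
    change ht m ((x :: a) ++ b) ≤ 0
    rw [ht_append]; omega

lemma Sfx.left {a b : List Bool} (h : Sfx m (a ++ b)) (hb : ht m b = 0) : Sfx m a := by
  induction a with
  | nil => trivial
  | cons x a ih =>
    refine ⟨?_, ih h.2⟩
    have h1 := h.ht_le
    rw [ht_append] at h1; omega

lemma Sfx.false_cons {b : List Bool} (h : Sfx m b) : Sfx m (false :: b) := by
  refine ⟨?_, h⟩
  have := h.ht_le
  simp; omega

/-- Dyck words through heights. -/
def Dy (m : ℕ) (w : List Bool) : Prop := ht m w = 0 ∧ Sfx m w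

lemma sfx_iff (w : List Bool) : Sfx m w ↔ ∀ a b, w = a ++ b → ht m b ≤ 0 := by
  constructor
  · rintro h a b rfl
    exact h.right.ht_le
  · intro h
    induction w with
    | nil => trivial
    | cons x w ih =>
      refine ⟨h [] _ rfl, ih ?_⟩
      rintro a b rfl
      exact h (x :: a) b rfl

lemma isDyck_iff (w : List Bool) : IsDyck m w ↔ Dy m w := by
  unfold IsDyck Dy
  have h0 : w.count false = m * w.count true ↔ ht m w = 0 := by
    rw [ht_eq, sub_eq_zero, eq_comm]; norm_cast
  have hp : ∀ p : List Bool, p.count false ≤ m * p.count true ↔ 0 ≤ ht m p := by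
    intro p; rw [ht_eq, sub_nonneg]; norm_cast
  rw [h0, sfx_iff]
  refine and_congr_right fun h => ⟨?_, ?_⟩
  · rintro H a b rfl
    have := (hp a).1 (H a (List.prefix_append a b))
    rw [ht_append] at h; omega
  · rintro H p ⟨b, rfl⟩
    have := H p b rfl
    rw [hp]
    rw [ht_append] at h; omega

lemma Dy.append {a b : List Bool} (ha : Dy m a) (hb : Dy m b) : Dy m (a ++ b) :=
  ⟨by rw [ht_append, ha.1, hb.1]; rfl, ha.2.append hb.2⟩

lemma Dy.nil : Dy m [] := ⟨rfl, trivial⟩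

/-- Primitive Dyck words. -/
def Prim (m : ℕ) (d : List Bool) : Prop :=
  d ≠ [] ∧ Dy m d ∧ ∀ d' : List Bool, d' <+: d → Dy m d' → d' ≠ [] → d.length ≤ d'.length

lemma ordCover_iff (w w' : List Bool) : OrdCover m w w' ↔
    ∃ u d v, Prim m d ∧ w = u ++ false :: (d ++ v) ∧ w' = u ++ d ++ false :: v := by
  unfold OrdCover Prim
  simp only [isDyck_iff]
  constructor
  · rintro ⟨u, d, v, h1, h2, h3, h4, h5⟩
    exact ⟨u, d, v, ⟨h1, h2, fun d' hd' => h5 d' (hd'.trans (List.prefix_append d v))⟩, h3, h4⟩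
  · rintro ⟨u, d, v, ⟨h1, h2, h5⟩, h3, h4⟩
    refine ⟨u, d, v, h1, h2, h3, h4, fun d' hd' hD hne => ?_⟩
    rcases le_total d'.length d.length with h | h
    · exact h5 d' (List.prefix_of_prefix_length_le hd' (List.prefix_append d v) h) hD hne
    · exact h

lemma cover_ctx {w w' : List Bool} (h : OrdCover m w w') (a b : List Bool) :
    OrdCover m (a ++ w ++ b) (a ++ w' ++ b) := by
  rw [ordCover_iff] at h ⊢
  obtain ⟨u, d, v, hd, rfl, rfl⟩ := h
  exact ⟨a ++ u, d, v ++ b, hd, by simp, by simp⟩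

lemma le_ctx {w w' : List Bool} (h : OrdLe m w w') (a b : List Bool) :
    OrdLe m (a ++ w ++ b) (a ++ w' ++ b) :=
  Relation.ReflTransGen.lift (fun w => a ++ w ++ b) (fun _ _ h => cover_ctx h a b) _ _ h

lemma cover_perm {w w' : List Bool} (h : OrdCover m w w') : w.Perm w' := by
  obtain ⟨u, d, v, -, -, rfl, rfl, -⟩ := h
  rw [List.append_assoc]
  exact List.Perm.append_left u List.perm_middle.symm

lemma le_perm {w w' : List Bool} (h : OrdLe m w w') : w.Perm w' := by
  induction h with
  | refl => exact List.Perm.refl _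
  | tail _ h ih => exact ih.trans (cover_perm h)

lemma ht_perm {w w' : List Bool} (h : w.Perm w') : ht m w = ht m w' := by
  rw [ht_eq, ht_eq, h.count_eq, h.count_eq]

/-- Moving a down step through a Dyck word. -/
lemma move_le : ∀ (N : ℕ) (r : List Bool), r.length ≤ N → Dy m r →
    OrdLe m (false :: r) (r ++ [false]) := by
  intro N
  induction N with
  | zero =>
    intro r hr _
    have : r = [] := List.length_eq_zero_iff.1 (by omega)
    subst this
    exact Relation.ReflTransGen.refl
  | succ N ih =>
    intro r hr hD
    by_cases hne : r = []
    · subst hne; exact Relation.ReflTransGen.refl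
    classical
    have hex : ∃ l, ∃ d, d <+: r ∧ Dy m d ∧ d ≠ [] ∧ d.length = l :=
      ⟨_, r, List.prefix_refl r, hD, hne, rfl⟩
    obtain ⟨d, ⟨v, rfl⟩, hd, hdne, hl⟩ := Nat.find_spec hex
    have hP : Prim m d := by
      refine ⟨hdne, hd, fun d' h1 h2 h3 => ?_⟩
      rw [hl]
      exact Nat.find_min' hex ⟨d', h1.trans (List.prefix_append d v), h2, h3, rfl⟩
    have hv : Dy m v := by
      refine ⟨?_, hD.2.right⟩
      have := hD.1
      rw [ht_append, hd.1] at this; omega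
    have hlen : 0 < d.length := List.length_pos_iff.2 hdne
    have h2 := ih v (by simp at hr; omega) hv
    have h1 : OrdCover m (false :: (d ++ v)) (d ++ false :: v) := by
      rw [ordCover_iff]; exact ⟨[], d, v, hP, by simp, by simp⟩
    refine Relation.ReflTransGen.head h1 ?_
    have := le_ctx h2 d []
    simp only [List.append_assoc, List.append_nil] at this ⊢
    exact this

lemma compose_le {a b q1 p2 q2 : List Bool} (hb : Dy m b) (h1 : OrdLe m (a ++ b) q1)
    (h2 : OrdLe m p2 q2) : OrdLe m (a ++ false :: (b ++ p2)) (q1 ++ false :: q2) := by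
  have s1 := le_ctx (move_le b.length b le_rfl hb) a p2
  have s2 := le_ctx h1 [] (false :: p2)
  have s3 := le_ctx h2 (q1 ++ [false]) []
  simp only [List.append_assoc, List.cons_append, List.nil_append, List.append_nil] at s1 s2 s3
  exact (s1.trans s2).trans s3

lemma sfx_cover {w w' : List Bool} (h : OrdCover m w w') (hs : Sfx m w') : Sfx m w := by
  rw [ordCover_iff] at h
  obtain ⟨u, d, v, hd, rfl, rfl⟩ := h
  induction u with
  | nil =>
    simp only [List.nil_append] at *
    have hv : Sfx m v := hs.right.2
    exact (hd.2.1.2.append hv).false_cons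
  | cons x u ih =>
    refine ⟨?_, ih hs.2⟩
    have := hs.ht_le
    change ht m ((x :: u) ++ false :: (d ++ v)) ≤ 0
    rw [ht_append]
    rw [ht_append, ht_append] at this
    simp [hd.2.1.1] at this ⊢
    omega

lemma cover_decomp {p rl rr r2 : List Bool} (hrl : Sfx m rl) (hrr : Dy m rr) (hr2 : Dy m r2)
    (h : OrdCover m p (rl ++ false :: (rr ++ r2))) :
    ∃ pl pr p2, p = pl ++ false :: (pr ++ p2) ∧ Sfx m pl ∧ Dy m pr ∧ Dy m p2 ∧
      OrdLe m (pl ++ pr) (rl ++ rr) ∧ OrdLe m p2 r2 := by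
  have h0 := h
  rw [ordCover_iff] at h
  obtain ⟨u, d, v, hd, rfl, h⟩ := h
  have hdy := hd.2.1
  have mk : ∀ u d v, Prim m d → OrdCover m (u ++ false :: (d ++ v)) (u ++ d ++ false :: v) :=
    fun u d v hd => (ordCover_iff _ _).2 ⟨u, d, v, hd, rfl, rfl⟩
  rcases List.append_eq_append_iff.1 h with ⟨s, h1, h2⟩ | ⟨s, h1, h2⟩
  · -- u ++ d = rl ++ s, false :: (rr ++ r2) = s ++ false :: v
    rcases s with _ | ⟨x, s⟩
    · simp only [List.append_nil, List.nil_append, List.cons.injEq, true_and] at h1 h2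
      subst h1 h2
      refine ⟨u, d ++ rr, r2, by simp, hrl.left hdy.1, hdy.append hrr, hr2, ?_, ?_⟩
      · rw [List.append_assoc]; exact Relation.ReflTransGen.refl
      · exact Relation.ReflTransGen.refl
    · simp only [List.cons_append, List.cons.injEq] at h2
      obtain ⟨rfl, h2⟩ := h2
      have hS : Dy m (rr ++ r2) := hrr.append hr2
      rcases List.append_eq_append_iff.1 (show u ++ d = (rl ++ [false]) ++ s by simpa using h1)
        with ⟨e, h3, h4⟩ | ⟨e, h3, h4⟩
      · exfalso
        have hs1 : ht m s ≤ 0 := by rw [h4] at hdy; exact hdy.2.right.ht_le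
        have hs2 := hS.1
        have hs3 := hS.2
        rw [h2] at hs2 hs3
        have hs4 := hs3.right.2.ht_le
        simp at hs2; omega
      · subst h3 h4
        rw [List.append_assoc] at h2
        rcases List.append_eq_append_iff.1 h2 with ⟨f, h5, h6⟩ | ⟨f, h5, h6⟩
        · -- e = rr ++ f, f ++ (d ++ false :: v) = r2
          subst h5
          refine ⟨rl, rr, f ++ false :: (d ++ v), by simp, hrl, hrr, ?_,
            Relation.ReflTransGen.refl, ?_⟩
          · have hc := mk f d v hd
            rw [List.append_assoc, ← h6] at hc
            exact ⟨by rw [ht_perm (cover_perm hc), hr2.1], sfx_cover hc hr2.2⟩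
          · have hc := mk f d v hd
            rw [List.append_assoc, ← h6] at hc
            exact Relation.ReflTransGen.single hc
        · -- rr = e ++ f, d ++ false :: v = f ++ r2
          rcases List.append_eq_append_iff.1 h6 with ⟨g, h7, h8⟩ | ⟨g, h7, h8⟩
          · rcases g with _ | ⟨x, g⟩
            · exfalso
              simp only [List.nil_append] at h8
              rw [← h8] at hr2
              have := hr2.1
              have h9 := hr2.2.2.ht_le
              simp at this; omega
            · simp only [List.cons_append, List.cons.injEq] at h8
              obtain ⟨rfl, rfl⟩ := h8
              have hc := mk e d g hd
              have hrr' : rr = e ++ d ++ false :: g := by rw [h5, h7]; simp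
              rw [← hrr'] at hc
              refine ⟨rl, e ++ false :: (d ++ g), r2, by simp, hrl, ?_, hr2, ?_,
                Relation.ReflTransGen.refl⟩
              · exact ⟨by rw [ht_perm (cover_perm hc), hrr.1], sfx_cover hc hrr.2⟩
              · have := cover_ctx hc rl []
                simp only [List.append_nil] at this
                exact Relation.ReflTransGen.single this
          · exfalso
            have hg1 : ht m g ≤ 0 := by rw [h7] at hdy; exact hdy.2.right.ht_le
            have hg2 := hr2.1
            have hg3 := hr2.2
            rw [h8] at hg2 hg3
            have hg4 := hg3.right.2.ht_le
            simp at hg2; omega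
  · rcases s with _ | ⟨x, s⟩
    · simp only [List.append_nil, List.nil_append, List.cons.injEq, true_and] at h1 h2
      subst h1 h2
      refine ⟨u, d ++ rr, r2, by simp, hrl.left hdy.1, hdy.append hrr, hr2, ?_, ?_⟩
      · rw [List.append_assoc]; exact Relation.ReflTransGen.refl
      · exact Relation.ReflTransGen.refl
    · simp only [List.cons_append, List.cons.injEq] at h2
      obtain ⟨rfl, h2⟩ := h2
      subst h1 h2
      have hc := mk u d s hd
      refine ⟨u ++ false :: (d ++ s), rr, r2, by simp, sfx_cover hc hrl, hrr, hr2, ?_,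
        Relation.ReflTransGen.refl⟩
      have := cover_ctx hc [] rr
      exact Relation.ReflTransGen.single this

lemma le_decomp {p q1 q2 : List Bool} (h1 : Sfx m q1) (h2 : Dy m q2)
    (h : OrdLe m p (q1 ++ false :: q2)) :
    ∃ pl pr p2, p = pl ++ false :: (pr ++ p2) ∧ Sfx m pl ∧ Dy m pr ∧ Dy m p2 ∧
      OrdLe m (pl ++ pr) q1 ∧ OrdLe m p2 q2 := by
  induction h using Relation.ReflTransGen.head_induction_on with
  | refl => exact ⟨q1, [], q2, by simp, h1, Dy.nil, h2, by
      rw [List.append_nil]; exact Relation.ReflTransGen.refl, Relation.ReflTransGen.refl⟩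
  | head hc _ ih =>
    obtain ⟨rl, rr, r2, rfl, a1, a2, a3, a4, a5⟩ := ih
    obtain ⟨pl, pr, p2, b1, b2, b3, b4, b5, b6⟩ := cover_decomp a1 a2 a3 hc
    exact ⟨pl, pr, p2, b1, b2, b3, b4, b5.trans a4, b6.trans a5⟩

lemma le_true_cons {p q : List Bool} : OrdLe m (true :: p) (true :: q) ↔ OrdLe m p q := by
  constructor
  · intro h
    have key : ∀ x y, OrdLe m x y → ∀ p, x = true :: p → ∃ q, y = true :: q ∧ OrdLe m p q := by
      intro x y h
      induction h with
      | refl => intro p hp; exact ⟨p, hp, Relation.ReflTransGen.refl⟩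
      | tail _ hc ih =>
        intro p hp
        obtain ⟨q, rfl, hq⟩ := ih p hp
        rw [ordCover_iff] at hc
        obtain ⟨u, d, v, hd, e1, rfl⟩ := hc
        rcases u with _ | ⟨x, u⟩
        · simp at e1
        · simp only [List.cons_append, List.cons.injEq] at e1
          obtain ⟨rfl, rfl⟩ := e1
          exact ⟨u ++ d ++ false :: v, by simp, hq.tail ((ordCover_iff _ _).2
            ⟨u, d, v, hd, rfl, rfl⟩)⟩
    obtain ⟨q', e, h⟩ := key _ _ h p rfl
    cases e; exact h
  · intro h
    simpa using le_ctx h [true] []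

/-- Existence of the decomposition of a word of negative height. -/
lemma exists_decomp : ∀ {w : List Bool}, Sfx m w → ht m w < 0 →
    ∃ a b, w = a ++ false :: b ∧ Sfx m a ∧ Dy m b := by
  intro w
  induction w with
  | nil => intro _ h; simp at h
  | cons x w ih =>
    intro hs hh
    have aux : ht m w < 0 → ∃ a b, x :: w = a ++ false :: b ∧ Sfx m a ∧ Dy m b := by
      intro hw
      obtain ⟨a, b, rfl, ha, hb⟩ := ih hs.2 hw
      refine ⟨x :: a, b, rfl, ⟨?_, ha⟩, hb⟩
      have h1 := hb.1
      rw [← List.cons_append, ht_append] at hh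
      simp only [ht_false, h1] at hh
      omega
    cases x with
    | true => exact aux (by simp at hh; omega)
    | false =>
      rcases lt_or_eq_of_le hs.2.ht_le with h | h
      · exact aux h
      · exact ⟨[], w, rfl, trivial, h, hs.2⟩

lemma decomp_unique {a b a' b' : List Bool} (ha : Sfx m a) (ha' : Sfx m a') (hb : ht m b = 0)
    (hb' : ht m b' = 0) (h : a ++ false :: b = a' ++ false :: b') : a = a' ∧ b = b' := by
  have key : ∀ {a b a' b' : List Bool}, Sfx m a' → ht m b = 0 → ht m b' = 0 →
      ∀ s, a' = a ++ s → false :: b = s ++ false :: b' → a = a' ∧ b = b' := by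
    intro a b a' b' ha' hb hb' s h1 h2
    rcases s with _ | ⟨x, s⟩
    · simp only [List.append_nil, List.nil_append, List.cons.injEq, true_and] at h1 h2
      exact ⟨h1.symm, h2⟩
    · exfalso
      simp only [List.cons_append, List.cons.injEq] at h2
      obtain ⟨rfl, rfl⟩ := h2
      subst h1
      have := ha'.right.2.ht_le
      simp at hb; omega
  rcases List.append_eq_append_iff.1 h with ⟨s, h1, h2⟩ | ⟨s, h1, h2⟩
  · exact key ha' hb hb' s h1 h2
  · obtain ⟨h3, h4⟩ := key ha hb' hb s h1 h2
    exact ⟨h3.symm, h4.symm⟩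

/-- Words of type `k` and size `n`. -/
def Wd (m k n : ℕ) (w : List Bool) : Prop := Sfx m w ∧ ht m w = -(k : ℤ) ∧ w.count true = n

/-- Intervals. -/
def IntSet (m k n : ℕ) : Set (List Bool × List Bool) :=
  {pq | Wd m k n pq.1 ∧ Wd m k n pq.2 ∧ OrdLe m pq.1 pq.2}

lemma Wd.length {k n : ℕ} {w : List Bool} (h : Wd m k n w) : w.length = n + m * n + k := by
  obtain ⟨_, h2, h3⟩ := h
  rw [ht_eq, h3] at h2
  have := List.count_true_add_count_false w
  zify
  zify at this
  rw [h3] at this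
  linarith

lemma intSet_finite (m k n : ℕ) : (IntSet m k n).Finite := by
  have := (List.finite_length_eq Bool (n + m * n + k)).prod
    (List.finite_length_eq Bool (n + m * n + k))
  refine this.subset ?_
  rintro ⟨p, q⟩ ⟨h1, h2, -⟩
  exact ⟨h1.length, h2.length⟩

/-- Intervals as a finset. -/
noncomputable def Int (m k n : ℕ) : Finset (List Bool × List Bool) := (intSet_finite m k n).toFinset

lemma mem_Int {k n : ℕ} {p q : List Bool} :
    (p, q) ∈ Int m k n ↔ Wd m k n p ∧ Wd m k n q ∧ OrdLe m p q := by
  unfold Int; rw [Set.Finite.mem_toFinset]; rfl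

/-- Splittings of a word with right part of height zero. -/
def spl (m : ℕ) : List Bool → Finset (List Bool × List Bool)
  | [] => {([], [])}
  | x :: w => (spl m w).image (fun ab => (x :: ab.1, ab.2)) ∪
      if ht m (x :: w) = 0 then {([], x :: w)} else ∅

lemma mem_spl {p a b : List Bool} : (a, b) ∈ spl m p ↔ p = a ++ b ∧ ht m b = 0 := by
  induction p generalizing a b with
  | nil =>
    simp only [spl, Finset.mem_singleton, Prod.mk.injEq]
    constructor
    · rintro ⟨rfl, rfl⟩; simp
    · rintro ⟨h, -⟩
      have := List.append_eq_nil_iff.1 h.symm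
      exact this
  | cons x w ih =>
    simp only [spl, Finset.mem_union, Finset.mem_image, Prod.exists, Prod.mk.injEq]
    constructor
    · rintro (⟨a', b', h, rfl, rfl⟩ | h)
      · obtain ⟨e, h⟩ := ih.1 h
        exact ⟨by rw [e]; rfl, h⟩
      · split_ifs at h with h0
        · simp only [Finset.mem_singleton, Prod.mk.injEq] at h
          obtain ⟨rfl, rfl⟩ := h
          exact ⟨rfl, h0⟩
        · simp at h
    · rintro ⟨h, hb⟩
      rcases a with _ | ⟨y, a⟩
      · right
        simp only [List.nil_append] at h
        subst h
        rw [if_pos hb]; simp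
      · left
        simp only [List.cons_append, List.cons.injEq] at h
        exact ⟨a, b, ih.2 ⟨h.2, hb⟩, by rw [h.1], rfl⟩

lemma con_pos (w : List Bool) : 0 < con m w := by
  induction w with
  | nil => simp [con]
  | cons x w ih => simp only [con]; omega

lemma sum_spl {A : Type*} [CommRing A] (x : A) (p : List Bool) :
    ∑ ab ∈ spl m p, x ^ (con m ab.2 - 1) = ∑ s ∈ Finset.range (con m p), x ^ s := by
  induction p with
  | nil => simp [spl, con]
  | cons y w ih =>
    simp only [spl]
    rw [Finset.sum_union, Finset.sum_image, ih]
    · simp only [con]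
      split_ifs with h
      · rw [Finset.sum_range_succ]
        simp [con, h]
      · simp
    · rintro ⟨a, b⟩ _ ⟨a', b'⟩ _ h
      simpa using h
    · rw [Finset.disjoint_left]
      rintro ⟨a, b⟩ h1 h2
      simp only [Finset.mem_image, Prod.mk.injEq] at h1
      obtain ⟨_, _, rfl, _⟩ := h1
      split_ifs at h2 <;> simp at h2

lemma con_append {b c : List Bool} (hc : ht m c = 0) :
    con m (b ++ c) = con m b - 1 + con m c := by
  induction b with
  | nil => simp [con]
  | cons x b ih =>
    have := con_pos (m := m) b
    simp only [List.cons_append, con, ih]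
    rw [← List.cons_append, ht_append, hc, add_zero]
    omega

lemma con_mid {a c : List Bool} (ha : Sfx m a) (hc : ht m c = 0) :
    con m (a ++ false :: c) = con m c := by
  induction a with
  | nil => simp [con, hc]
  | cons x a ih =>
    have h1 := ha.ht_le
    simp only [List.cons_append, con, ih ha.2]
    rw [← List.cons_append, ht_append, ht_false, hc, if_neg (by omega), add_zero]

section gf
variable {A : Type*} [CommRing A]

/-- Weighted count of intervals. -/
noncomputable def fs (m : ℕ) (x : A) (k n : ℕ) : A := ∑ pq ∈ Int m k n, x ^ con m pq.1

/-- Weighted count of pointed intervals. -/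
noncomputable def ds (m : ℕ) (x : A) (k n : ℕ) : A :=
  ∑ pq ∈ Int m k n, ∑ s ∈ Finset.range (con m pq.1), x ^ s

lemma ds_mul (x : A) (k n : ℕ) : ds m x k n * (x - 1) = fs m x k n - (Int m k n).card := by
  unfold ds fs
  rw [Finset.sum_mul]
  simp_rw [geom_sum_mul]
  rw [Finset.sum_sub_distrib]; simp

lemma fs_zero (x : A) : fs m x 0 0 = x := by
  have : Int m 0 0 = {([], [])} := by
    ext ⟨p, q⟩
    rw [mem_Int]
    simp only [Finset.mem_singleton, Prod.mk.injEq]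
    constructor
    · rintro ⟨h1, h2, -⟩
      exact ⟨List.length_eq_zero_iff.1 (by simpa using h1.length),
        List.length_eq_zero_iff.1 (by simpa using h2.length)⟩
    · rintro ⟨rfl, rfl⟩
      exact ⟨⟨trivial, by simp, rfl⟩, ⟨trivial, by simp, rfl⟩, Relation.ReflTransGen.refl⟩
  unfold fs
  rw [this]; simp [con]

lemma wd_true_cons {n : ℕ} {w : List Bool} : Wd m 0 (n + 1) (true :: w) ↔ Wd m m n w := by
  have hS : Sfx m (true :: w) ↔ ht m (true :: w) ≤ 0 ∧ Sfx m w := Iff.rfl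
  unfold Wd
  rw [hS]
  simp only [ht_true, List.count_cons_self]
  constructor
  · rintro ⟨⟨h1, h2⟩, h3, h4⟩; exact ⟨h2, by push_cast at h3; omega, by omega⟩
  · rintro ⟨h1, h3, h4⟩; exact ⟨⟨by omega, h1⟩, by push_cast; omega, by omega⟩

lemma wd_succ {n : ℕ} {w : List Bool} (h : Wd m 0 (n + 1) w) : ∃ w', w = true :: w' := by
  obtain ⟨h1, h2, h3⟩ := h
  rcases w with _ | ⟨x, w⟩
  · simp at h3
  · cases x with
    | true => exact ⟨w, rfl⟩
    | false =>
      exfalso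
      have := h1.2.ht_le
      simp at h2; omega

lemma fs_succ (x : A) (n : ℕ) : fs m x 0 (n + 1) = x * fs m x m n := by
  unfold fs
  rw [Finset.mul_sum]
  symm
  refine Finset.sum_bij (fun pq _ => (true :: pq.1, true :: pq.2)) ?_ ?_ ?_ ?_
  · rintro ⟨p, q⟩ h
    rw [mem_Int] at h ⊢
    exact ⟨wd_true_cons.2 h.1, wd_true_cons.2 h.2.1, le_true_cons.2 h.2.2⟩
  · rintro ⟨p, q⟩ _ ⟨p', q'⟩ _ h
    simpa using h
  · rintro ⟨p, q⟩ h
    rw [mem_Int] at h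
    obtain ⟨h1, h2, h3⟩ := h
    obtain ⟨p, rfl⟩ := wd_succ h1
    obtain ⟨q, rfl⟩ := wd_succ h2
    exact ⟨(p, q), mem_Int.2 ⟨wd_true_cons.1 h1, wd_true_cons.1 h2, le_true_cons.1 h3⟩, rfl⟩
  · rintro ⟨p, q⟩ h
    rw [mem_Int] at h
    have h1 := (wd_true_cons.2 h.1).2.1
    have : con m (true :: p) = con m p + 1 := by
      rw [con, if_pos (by simpa using h1)]
    simp only [this, pow_succ]; ring

lemma Wd.dy {n : ℕ} {w : List Bool} (h : Wd m 0 n w) : Dy m w := ⟨by simpa using h.2.1, h.1⟩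

lemma wd_join {k i j : ℕ} {a b : List Bool} (ha : Wd m k i a) (hb : Wd m 0 j b) :
    Wd m (k + 1) (i + j) (a ++ false :: b) := by
  refine ⟨ha.1.append hb.1.false_cons, ?_, ?_⟩
  · rw [ht_append, ht_false, ha.2.1, hb.2.1]; push_cast; ring
  · simp [ha.2.2, hb.2.2]

lemma fs_step (x : A) (k n : ℕ) : fs m x (k + 1) n =
    ∑ ij ∈ Finset.HasAntidiagonal.antidiagonal n, ds m x k ij.1 * fs m x 0 ij.2 := by
  have h1 : ∀ ij : ℕ × ℕ, ds m x k ij.1 * fs m x 0 ij.2 =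
      ∑ y ∈ ((Int m k ij.1).sigma (fun pq => spl m pq.1)) ×ˢ Int m 0 ij.2,
        x ^ (con m y.1.2.2 - 1 + con m y.2.1) := by
    intro ij
    rw [Finset.sum_product]
    unfold ds fs
    simp_rw [← sum_spl]
    rw [Finset.sum_sigma', Finset.sum_mul_sum]
    simp_rw [pow_add]
  simp_rw [h1]
  rw [Finset.sum_sigma']
  unfold fs
  symm
  refine Finset.sum_bij (fun y _ => (y.2.1.2.1 ++ false :: (y.2.1.2.2 ++ y.2.2.1),
    y.2.1.1.2 ++ false :: y.2.2.2)) ?_ ?_ ?_ ?_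
  · rintro ⟨⟨i, j⟩, ⟨⟨p, q⟩, ⟨a, b⟩⟩, ⟨p2, q2⟩⟩ h
    simp only [Finset.mem_sigma, Finset.HasAntidiagonal.mem_antidiagonal, Finset.mem_product, mem_Int, mem_spl] at h ⊢
    obtain ⟨rfl, ⟨⟨hp, hq, hle⟩, rfl, hb⟩, hp2, hq2, hle2⟩ := h
    refine ⟨?_, wd_join hq hq2, compose_le ⟨hb, hp.1.right⟩ hle hle2⟩
    have hw := wd_join hp hp2
    refine ⟨(hp.1.left hb).append (hp.1.right.append hp2.1).false_cons, ?_, ?_⟩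
    · rw [← hw.2.1]; simp only [ht_append, ht_false]; ring
    · rw [← hw.2.2]; simp
  · rintro ⟨⟨i, j⟩, ⟨⟨p, q⟩, ⟨a, b⟩⟩, ⟨p2, q2⟩⟩ h ⟨⟨i', j'⟩, ⟨⟨p', q'⟩, ⟨a', b'⟩⟩, ⟨p2', q2'⟩⟩ h' e
    simp only [Finset.mem_sigma, Finset.HasAntidiagonal.mem_antidiagonal, Finset.mem_product, mem_Int, mem_spl] at h h'
    obtain ⟨rfl, ⟨⟨hp, hq, hle⟩, rfl, hb⟩, hp2, hq2, hle2⟩ := h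
    obtain ⟨hij, ⟨⟨hp', hq', hle'⟩, rfl, hb'⟩, hp2', hq2', hle2'⟩ := h'
    simp only [Prod.mk.injEq] at e
    obtain ⟨e1, e2⟩ := e
    obtain ⟨rfl, rfl⟩ := decomp_unique hq.1 hq'.1 hq2.dy.1 hq2'.dy.1 e2
    obtain ⟨rfl, e3⟩ := decomp_unique (hp.1.left hb) (hp'.1.left hb')
      (by rw [ht_append, hb, hp2.dy.1]; rfl) (by rw [ht_append, hb', hp2'.dy.1]; rfl) e1
    have hj : j = j' := by rw [← hq2.2.2, ← hq2'.2.2]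
    have hi : i = i' := by rw [← hq.2.2, ← hq'.2.2]
    subst hi hj
    have hl : p2.length = p2'.length := by rw [hp2.length, hp2'.length]
    obtain ⟨rfl, rfl⟩ := List.append_inj' e3 hl
    rfl
  · rintro ⟨p, q⟩ h
    rw [mem_Int] at h
    obtain ⟨hp, hq, hle⟩ := h
    obtain ⟨q1, q2, rfl, hq1, hq2⟩ := exists_decomp hq.1 (by rw [hq.2.1]; push_cast; omega)
    obtain ⟨a, b, p2, rfl, ha, hb, hp2, l1, l2⟩ := le_decomp hq1 hq2 hle
    have e1 := le_perm l1
    have e2 := le_perm l2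
    have hht := hq.2.1
    rw [ht_append, ht_false, hq2.1] at hht
    have hc := hq.2.2
    rw [List.count_append, List.count_cons_of_ne (by simp)] at hc
    have hq1' : Wd m k (q1.count true) q1 := ⟨hq1, by push_cast at hht; omega, rfl⟩
    refine ⟨⟨(q1.count true, q2.count true), ⟨⟨(a ++ b, q1), (a, b)⟩, (p2, q2)⟩⟩, ?_, rfl⟩
    simp only [Finset.mem_sigma, Finset.HasAntidiagonal.mem_antidiagonal, Finset.mem_product, mem_Int, mem_spl]
    refine ⟨hc, ⟨⟨⟨ha.append hb.2, ?_, e1.count_eq _⟩, hq1', l1⟩, by simp, hb.1⟩,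
      ⟨hp2.2, by simpa using hp2.1, e2.count_eq _⟩, ⟨hq2.2, by simpa using hq2.1, rfl⟩, l2⟩
    rw [ht_perm e1, hq1'.2.1]
  · rintro ⟨⟨i, j⟩, ⟨⟨p, q⟩, ⟨a, b⟩⟩, ⟨p2, q2⟩⟩ h
    simp only [Finset.mem_sigma, Finset.HasAntidiagonal.mem_antidiagonal, Finset.mem_product, mem_Int, mem_spl] at h
    obtain ⟨rfl, ⟨⟨hp, hq, hle⟩, rfl, hb⟩, hp2, hq2, hle2⟩ := h
    simp only
    rw [con_mid (hp.1.left hb) (by rw [ht_append, hb, hp2.dy.1]; rfl), con_append hp2.dy.1]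

end gf

section alg
open PowerSeries
variable {R : Type*} [CommRing R]

/-- The shift `(S - S(0)) / u`. -/
noncomputable def sh (S : R⟦X⟧) : R⟦X⟧ := PowerSeries.mk fun n => coeff (n + 1) S

lemma X_mul_sh (S : R⟦X⟧) : X * sh S = S - C (constantCoeff S) :=
  (sub_const_eq_X_mul_shift S).symm

lemma sh_sub (S S' : R⟦X⟧) : sh (S - S') = sh S - sh S' := by
  ext n; simp [sh]

lemma sh_C_mul (r : R) (S : R⟦X⟧) : sh (C r * S) = C r * sh S := by
  ext n; simp [sh]

lemma sh_dvd {r : R} {S : R⟦X⟧} (h : C r ∣ S) : C r ∣ sh S := by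
  obtain ⟨S', rfl⟩ := h
  exact ⟨_, sh_C_mul r S'⟩

/-- Span of `Q ^ i * u ^ (k - i)` for `1 ≤ i ≤ k`. -/
def Msp (Q : R⟦X⟧) : ℕ → R⟦X⟧ → Prop
  | 0, d => d = 0
  | k + 1, d => ∃ d' r, Msp Q k d' ∧ d = X * d' + C r * Q ^ (k + 1)

variable {Q : R⟦X⟧}

lemma Msp.zero : ∀ k, Msp Q k 0
  | 0 => rfl
  | k + 1 => ⟨0, 0, Msp.zero k, by simp⟩

lemma Msp.add : ∀ {k} {d e : R⟦X⟧}, Msp Q k d → Msp Q k e → Msp Q k (d + e)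
  | 0, d, e, hd, he => by
    have hd' : d = 0 := hd
    have he' : e = 0 := he
    subst hd' he'; simp [Msp]
  | k + 1, d, e, ⟨d', r, hd, h1⟩, ⟨e', s, he, h2⟩ =>
    ⟨d' + e', r + s, hd.add he, by rw [h1, h2, map_add]; ring⟩

lemma Msp.smul (a : R) : ∀ {k} {d : R⟦X⟧}, Msp Q k d → Msp Q k (C a * d)
  | 0, d, hd => by
    have hd' : d = 0 := hd
    subst hd'; simp [Msp]
  | k + 1, d, ⟨d', r, hd, h1⟩ =>
    ⟨C a * d', a * r, hd.smul a, by rw [h1, map_mul]; ring⟩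

lemma Msp.X_mul {k} {d : R⟦X⟧} (hd : Msp Q k d) : Msp Q (k + 1) (X * d) :=
  ⟨d, 0, hd, by simp⟩

lemma Msp.Q_mul : ∀ {k} {d : R⟦X⟧}, Msp Q k d → Msp Q (k + 1) (Q * d)
  | 0, d, hd => by
    have hd' : d = 0 := hd
    subst hd'; rw [mul_zero]; exact Msp.zero _
  | k + 1, d, ⟨d', r, hd, h1⟩ =>
    ⟨Q * d', r, hd.Q_mul, by rw [h1]; ring⟩

lemma Msp.base : ∀ k, Msp Q (k + 1) (Q * X ^ k)
  | 0 => ⟨0, 1, rfl, by simp⟩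
  | k + 1 => by
    have := (Msp.base k).X_mul
    rwa [show X * (Q * X ^ k) = Q * X ^ (k + 1) by ring] at this

lemma Msp.unique [IsDomain R] (hQ : constantCoeff Q ≠ 0) :
    ∀ {k} {d D : R⟦X⟧}, Msp Q k d → d = X ^ k * D → D = 0
  | 0, d, D, hd, h => by
    have hd' : d = 0 := hd
    simpa [hd'] using h.symm
  | k + 1, d, D, ⟨d', r, hd, h1⟩, h => by
    have h2 : r = 0 := by
      have := congrArg constantCoeff (h1.symm.trans h)
      simp [hQ] at this
      exact this
    subst h2
    refine hd.unique hQ (d := d') ?_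
    have h3 : X * d' = X * (X ^ k * D) := by
      rw [← mul_assoc, ← pow_succ', ← h, h1]; simp
    exact mul_left_cancel₀ X_ne_zero h3

/-- The operator `S ↦ Q (S - S(0)) / u`. -/
noncomputable def phi (Q : R⟦X⟧) (S : R⟦X⟧) : R⟦X⟧ := Q * sh S

lemma phi_iter (G : R⟦X⟧) (k : ℕ) :
    ∃ e, Msp Q k e ∧ X ^ k * (phi Q)^[k] G = Q ^ k * G - e := by
  induction k with
  | zero => exact ⟨0, rfl, by simp⟩
  | succ k ih =>
    obtain ⟨e, he, h⟩ := ih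
    refine ⟨Q * e + C (constantCoeff ((phi Q)^[k] G)) * (Q * X ^ k),
      he.Q_mul.add ((Msp.base k).smul _), ?_⟩
    rw [Function.iterate_succ_apply']
    have := X_mul_sh ((phi Q)^[k] G)
    calc X ^ (k + 1) * phi Q ((phi Q)^[k] G)
        = X ^ k * Q * (X * sh ((phi Q)^[k] G)) := by unfold phi; ring
      _ = Q * (X ^ k * (phi Q)^[k] G)
          - C (constantCoeff ((phi Q)^[k] G)) * (Q * X ^ k) := by rw [this]; ring
      _ = _ := by rw [h]; ring

/-- The kernel polynomial. -/
noncomputable def QQ (z : R) : R⟦X⟧ := (1 + X) * (1 + C z * X)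

lemma sym_mem (z : R) : ∀ k : ℕ, Msp (QQ z) (k + 1)
    (C z * (1 + X) ^ (k + 2) + X ^ k * (1 + C z * X) ^ (k + 2) + C ((1 - z) ^ (k + 2)) * X ^ (k + 1))
  | 0 => by
    have := (Msp.base (Q := QQ z) 0).smul (1 + z)
    convert this using 1
    simp only [QQ, map_add, map_sub, map_pow, map_one]; ring
  | 1 => by
    have h1 := ((Msp.base (Q := QQ z) 0).Q_mul).smul z
    have h2 := (Msp.base (Q := QQ z) 1).smul ((1 - z) * (1 + 2 * z))
    convert h1.add h2 using 1
    simp only [QQ, map_add, map_sub, map_pow, map_one, map_mul, map_ofNat]; ring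
  | k + 2 => by
    have h1 := sym_mem z (k + 1)
    have h0 := sym_mem z k
    have a1 := h1.Q_mul
    have a2 := (h1.X_mul).smul (1 - z)
    have a3 := (h0.X_mul.Q_mul).smul (-1)
    have a4 := (Msp.base (Q := QQ z) (k + 2)).smul (z * (1 - z) ^ (k + 2))
    convert ((a1.add a2).add a3).add a4 using 1
    simp only [QQ, map_sub, map_pow, map_one, map_mul, map_neg]; ring

lemma main_alg [IsDomain R] (m : ℕ) (z c T : R) (b : R⟦X⟧) (hb : (1 + C z * X) * b = 1)
    (hc : c * (1 - z) ^ (m + 2) = 1) (hT : T * c ^ (m + 1) = z * c) :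
    C c * phi (QQ z) ((1 + X) * b ^ (m + 1)) = (1 + X) * b ^ (m + 1) + (1 + X) * b ^ (m + 1) *
      (C T * (C c ^ (m + 1) * (phi (QQ z))^[m + 1] ((1 + X) * b ^ (m + 1)))) := by
  set x : R⟦X⟧ := (1 + X) * b ^ (m + 1) with hx
  set β : R⟦X⟧ := 1 + C z * X with hβ
  have hβx : β ^ (m + 1) * x = 1 + X := by
    rw [hx, mul_left_comm, ← mul_pow, hb, one_pow, mul_one]
  have hβx2 : β ^ (m + 2) * x = QQ z := by
    rw [pow_succ', mul_assoc, hβx, QQ]; ring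
  obtain ⟨e, he, h⟩ := phi_iter (Q := QQ z) x (m + 1)
  set V := (phi (QQ z))^[m + 1] x with hV
  have hQx : QQ z ^ (m + 1) * x = (1 + X) ^ (m + 2) := by
    rw [QQ, mul_pow, mul_assoc, hβx]; ring
  rw [hQx] at h
  have hcx : constantCoeff x = 1 := by
    have h1 : constantCoeff b = 1 := by
      have := congrArg constantCoeff hb
      simpa [hβ] using this
    rw [hx]; simp [h1]
  have hsx := X_mul_sh x
  rw [hcx, map_one] at hsx
  have hC : C c * C ((1 - z) ^ (m + 2)) = (1 : R⟦X⟧) := by rw [← map_mul, hc, map_one]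
  have hCT : C T * C c ^ (m + 1) = (C z * C c : R⟦X⟧) := by
    rw [← map_pow, ← map_mul, hT, map_mul]
  have hD : C c * β ^ (m + 2) * sh x - 1 - C z * C c * V = 0 := by
    have s := sym_mem z m
    have hmem := (((Msp.base (Q := QQ z) m).smul c).add (s.smul (-c))).add (he.smul (z * c))
    refine hmem.unique (Q := QQ z) ?_ ?_
    · simp [QQ]
    · rw [← hβ]
      simp only [map_neg, map_mul]
      have e1 : X ^ (m + 1) * (C c * β ^ (m + 2) * sh x - 1 - C z * C c * V) =
        C c * X ^ m * β ^ (m + 2) * (X * sh x) - X ^ (m + 1) - C z * C c * (X ^ (m + 1) * V) := by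
        ring
      rw [e1, hsx, h]
      linear_combination (-X ^ (m + 1)) * hC - C c * X ^ m * hβx2
  rw [← mul_assoc (C T), hCT, phi]
  linear_combination x * hD - C c * sh x * hβx2

lemma coeff_one_x (m : ℕ) (z : R) (b : R⟦X⟧) (hb : (1 + C z * X) * b = 1) :
    constantCoeff (sh ((1 + X) * b ^ (m + 1))) = 1 - (m + 1) * z := by
  have h0 : constantCoeff b = 1 := by
    have := congrArg constantCoeff hb
    simpa using this
  have h1 : coeff 1 b = -z := by
    have := congrArg (coeff 1) hb
    rw [coeff_one_mul] at this
    simp [h0, coeff_one] at this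
    linear_combination this
  have : constantCoeff (sh ((1 + X) * b ^ (m + 1))) = coeff 1 ((1 + X) * b ^ (m + 1)) := by
    simp [sh, ← coeff_zero_eq_constantCoeff_apply]
  rw [this, coeff_one_mul, coeff_one_pow]
  simp [h0, h1, coeff_one]
  ring

lemma trunc_conv {A : Type*} [CommRing A] (t : A) (a b : ℕ → A) (N : ℕ) :
    t ^ N ∣ (∑ n ∈ Finset.range N, t ^ n * ∑ ij ∈ Finset.HasAntidiagonal.antidiagonal n,
        a ij.1 * b ij.2) -
      (∑ n ∈ Finset.range N, t ^ n * a n) * (∑ n ∈ Finset.range N, t ^ n * b n) := by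
  rw [Finset.sum_mul_sum, ← Finset.sum_product',
    ← Finset.sum_filter_add_sum_filter_not _ (fun ij : ℕ × ℕ => ij.1 + ij.2 < N)]
  have h1 : ∑ n ∈ Finset.range N, t ^ n * ∑ ij ∈ Finset.HasAntidiagonal.antidiagonal n,
        a ij.1 * b ij.2 = ∑ ij ∈ (Finset.range N ×ˢ Finset.range N).filter
          (fun ij : ℕ × ℕ => ij.1 + ij.2 < N), t ^ ij.1 * a ij.1 * (t ^ ij.2 * b ij.2) := by
    rw [← Finset.sum_fiberwise_of_maps_to (t := Finset.range N) (g := fun ij : ℕ × ℕ => ij.1 + ij.2)]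
    · refine Finset.sum_congr rfl fun n hn => ?_
      rw [Finset.mul_sum]
      refine Finset.sum_congr ?_ ?_
      · ext ⟨i, j⟩
        simp at hn ⊢
        omega
      · rintro ⟨i, j⟩ hij
        simp at hij
        obtain ⟨-, rfl⟩ := hij
        simp only [pow_add]; ring
    · rintro ⟨i, j⟩ h
      simpa using (Finset.mem_filter.1 h).2
  rw [h1, sub_add_cancel_left]
  refine (dvd_neg).2 (Finset.dvd_sum ?_)
  rintro ⟨i, j⟩ h
  have h2 := (Finset.mem_filter.1 h).2
  simp only at h2 ⊢
  have : t ^ N ∣ t ^ (i + j) := pow_dvd_pow t (by omega)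
  rw [show t ^ i * a i * (t ^ j * b j) = t ^ (i + j) * (a i * b j) by ring]
  exact this.mul_right _

lemma congr_main [IsDomain R] (m N : ℕ) (z c T T' : R) (b : R⟦X⟧) (hb : (1 + C z * X) * b = 1)
    (hc : c * (1 - z) ^ (m + 2) = 1) (hT : T * c ^ (m + 1) = z * c) (hzT : T = z * T')
    (hu : IsUnit (1 - (m + 1) * z)) :
    z ^ N ∣ (∑ n ∈ Finset.range N, T ^ n * ((Int m 0 n).card : R)) - c * (1 - (m + 1) * z) := by
  set x : R⟦X⟧ := (1 + X) * b ^ (m + 1) with hx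
  have hcx : constantCoeff x = 1 := by
    have h1 : constantCoeff b = 1 := by
      have := congrArg constantCoeff hb
      simpa using this
    rw [hx]; simp [h1]
  have hY0 := coeff_one_x m z b hb
  have hsx := X_mul_sh x
  rw [hcx, map_one] at hsx
  have hYu : IsUnit (sh x) := by
    rw [PowerSeries.isUnit_iff_constantCoeff, hY0]; exact hu
  obtain ⟨Yi, hYi⟩ := hYu.exists_right_inv
  set G : ℕ → R⟦X⟧ := fun k => ∑ n ∈ Finset.range N, C T ^ n * fs m x k n with hG
  set D : ℕ → R⟦X⟧ := fun k => ∑ n ∈ Finset.range N, C T ^ n * ds m x k n with hDdef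
  have hcG : ∀ k, constantCoeff (G k) =
      ∑ n ∈ Finset.range N, T ^ n * ((Int m k n).card : R) := by
    intro k
    simp only [hG, map_sum, map_mul, map_pow, fs, hcx, constantCoeff_C]
    simp
  have hDG : ∀ k, D k = Yi * sh (G k) := by
    intro k
    have h1 : X * (D k * sh x) = X * sh (G k) := by
      rw [X_mul_sh, hcG, mul_left_comm, hsx]
      simp only [hDdef, hG]
      rw [Finset.sum_mul]
      simp_rw [mul_assoc, ds_mul, mul_sub]
      rw [Finset.sum_sub_distrib]
      simp
    have h2 := mul_left_cancel₀ X_ne_zero h1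
    rw [← h2]
    linear_combination (-D k) * hYi
  have hzN : ∀ j ≤ N, (C (z ^ j) : R⟦X⟧) ∣ C T ^ N := by
    intro j hj
    rw [← map_pow]
    refine map_dvd C ?_
    rw [hzT, mul_pow]
    exact (pow_dvd_pow z hj).mul_right _
  have hstep : ∀ k, C T ^ N ∣ G (k + 1) - Yi * sh (G k) * G 0 := by
    intro k
    rw [← hDG]
    simp only [hG, hDdef, fs_step]
    exact trunc_conv _ _ _ _
  have hzero : C T ^ N ∣ G 0 - (x + x * (C T * G m)) := by
    rcases N with _ | N
    · simp
    · have : G 0 - (x + x * (C T * G m)) = - (C T ^ (N + 1) * (x * fs m x m N)) := by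
        simp only [hG]
        rw [Finset.sum_range_succ', Finset.sum_range_succ]
        simp only [fs_succ, fs_zero]
        have h3 : ∑ n ∈ Finset.range N, C T ^ (n + 1) * (x * fs m x m n) =
          x * C T * ∑ n ∈ Finset.range N, C T ^ n * fs m x m n := by
          rw [Finset.mul_sum]
          refine Finset.sum_congr rfl fun n _ => by ring
        rw [h3]; ring
      rw [this]
      exact (dvd_neg).2 (dvd_mul_right _ _)
  set S : ℕ → R⟦X⟧ := fun k => C c ^ (k + 1) * (phi (QQ z))^[k + 1] x with hS
  have hS0 : S 0 = C c * (QQ z * sh x) := by simp [hS, phi]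
  have hSstep : ∀ k, S (k + 1) = Yi * sh (S k) * S 0 := by
    intro k
    rw [hS0]
    simp only [hS]
    rw [Function.iterate_succ_apply', phi, ← map_pow C c (k + 1), sh_C_mul, map_pow]
    linear_combination (-C c ^ (k + 2) * QQ z * sh ((phi (QQ z))^[k + 1] x)) * hYi
  have hSzero : S 0 = x + x * (C T * S m) := by
    have := main_alg m z c T b hb hc hT
    simp only [hS]
    simpa using this
  have key : ∀ j ≤ N, C (z ^ j) ∣ G 0 - S 0 := by
    intro j
    induction j with
    | zero => intro _; simp
    | succ j ih =>
      intro hj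
      have h0 := ih (by omega)
      have hk : ∀ k, C (z ^ j) ∣ G k - S k := by
        intro k
        induction k with
        | zero => exact h0
        | succ k ihk =>
          have h1 := (hzN j (by omega)).trans (hstep k)
          have h2 : C (z ^ j) ∣ sh (G k) - sh (S k) := by rw [← sh_sub]; exact sh_dvd ihk
          have : G (k + 1) - S (k + 1) = (G (k + 1) - Yi * sh (G k) * G 0) +
            (Yi * G 0 * (sh (G k) - sh (S k)) + Yi * sh (S k) * (G 0 - S 0)) := by
            rw [hSstep]; ring
          rw [this]
          exact dvd_add h1 (dvd_add (h2.mul_left _) (h0.mul_left _))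
      have h1 := (hzN (j + 1) hj).trans hzero
      have : G 0 - S 0 = (G 0 - (x + x * (C T * G m))) + x * (C T * (G m - S m)) := by
        linear_combination (-1 : R⟦X⟧) * hSzero
      rw [this]
      refine dvd_add h1 (Dvd.dvd.mul_left ?_ _)
      rw [pow_succ', map_mul, hzT, map_mul, mul_assoc]
      exact mul_dvd_mul_left _ ((hk m).mul_left _)
  obtain ⟨E, hE⟩ := key N le_rfl
  have := congrArg constantCoeff hE
  rw [map_sub, hcG, hS0] at this
  refine ⟨constantCoeff E, ?_⟩
  rw [map_mul, map_mul, map_mul, hY0] at this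
  simpa [QQ] using this

end alg

section lagrange
open PowerSeries

/-- The inverse of `1 - z`. -/
noncomputable def wi : ℚ⟦X⟧ := PowerSeries.mk 1

lemma wi_mul : wi * (1 - X) = 1 := mk_one_mul_one_sub_eq_one ℚ

lemma coeff_wi (k d : ℕ) : coeff d (wi ^ (k + 1)) = (Nat.choose (k + d) d : ℚ) := by
  unfold wi
  rw [mk_one_pow_eq_mk_choose_add, coeff_mk, Nat.choose_symm_add]

lemma der_wi : derivative ℚ wi = wi ^ 2 := by
  have h := congrArg (derivative ℚ) wi_mul
  rw [Derivation.leibniz] at h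
  simp only [smul_eq_mul, map_sub, derivative_X, derivative_one] at h
  linear_combination wi * h - derivative ℚ wi * wi_mul

lemma der_wi_pow (k : ℕ) : derivative ℚ (wi ^ k) = k * wi ^ (k + 1) := by
  induction k with
  | zero => simp
  | succ k ih =>
    rw [pow_succ, Derivation.leibniz, ih, der_wi]
    simp only [smul_eq_mul]
    push_cast; ring

lemma coeff_lin (F : ℚ⟦X⟧) (s : ℚ) (p : ℕ) :
    coeff (p + 1) (F * (1 - C s * X)) = coeff (p + 1) F - s * coeff p F := by
  rw [show F * (1 - C s * X) = F - C s * (X * F) by ring]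
  simp [coeff_succ_X_mul]

lemma wi_one_sub (a b : ℕ) : wi ^ (a + b) * (1 - X) ^ b = wi ^ a := by
  rw [pow_add, mul_assoc, ← mul_pow, wi_mul, one_pow, mul_one]

/-- Lagrange functional on powers of `T`. -/
lemma lag_pow (e p d j : ℕ) (hj : j + d = p) :
    coeff p (derivative ℚ ((X * (1 - X) ^ e) ^ (j + 1)) * wi ^ (e * (p + 1))) =
      if d = 0 then (p + 1 : ℚ) else 0 := by
  have h1 : derivative ℚ ((X * (1 - X) ^ e) ^ (j + 1)) * wi ^ (e * (p + 1)) =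
      C (j + 1 : ℚ) * (X ^ j * (wi ^ (e * d + 1) * (1 - C (e + 1 : ℚ) * X))) := by
    have h2 : derivative ℚ ((X : ℚ⟦X⟧) * (1 - X) ^ e) * wi ^ e =
        wi * (1 - C (e + 1 : ℚ) * X) := by
      have : derivative ℚ ((X : ℚ⟦X⟧) * (1 - X) ^ e) * (1 - X) =
          (1 - X) ^ e * (1 - C (e + 1 : ℚ) * X) := by
        rw [Derivation.leibniz]
        simp only [smul_eq_mul, derivative_X]
        rcases e with _ | e
        · simp
        · rw [derivative_pow]
          simp only [map_sub, derivative_one, derivative_X, map_add, map_one, map_natCast,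
            Nat.add_sub_cancel]
          push_cast; ring
      have h3 := wi_one_sub 0 e
      have h4 := wi_mul
      simp only [zero_add, pow_zero] at h3
      linear_combination (-derivative ℚ ((X : ℚ⟦X⟧) * (1 - X) ^ e) * wi ^ e) * h4
        + wi ^ (e + 1) * this + wi * (1 - C (e + 1 : ℚ) * X) * h3
    have h5 := wi_one_sub 0 (e * j)
    simp only [zero_add, pow_zero] at h5
    rw [derivative_pow, ← hj]
    simp only [Nat.add_sub_cancel, map_add, map_one, map_natCast] at h2 ⊢
    have e1 : wi ^ (e * (j + d + 1)) = wi ^ (e * j) * wi ^ (e * d) * wi ^ e := by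
      rw [← pow_add, ← pow_add]; congr 1; ring
    rw [e1, mul_pow, ← pow_mul]
    push_cast
    linear_combination ((j : ℚ⟦X⟧) + 1) * X ^ j * wi ^ (e * d) * wi ^ (e * j) * (1 - X) ^ (e * j) * h2
      + ((j : ℚ⟦X⟧) + 1) * X ^ j * wi ^ (e * d) * (wi * (1 - ((e : ℚ⟦X⟧) + 1) * X)) * h5
  rw [h1, coeff_C_mul, ← hj, add_comm j d, coeff_X_pow_mul]
  rcases d with _ | d
  · simp [wi]
  · rw [if_neg (by omega), coeff_lin, coeff_wi, coeff_wi]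
    have h := Nat.add_one_mul_choose_eq (e * (d + 1) + d) d
    have h' : ((e * (d + 1) + d + 1 : ℕ) : ℚ) * (Nat.choose (e * (d + 1) + d) d : ℚ) =
      (Nat.choose (e * (d + 1) + d + 1) (d + 1) : ℚ) * (d + 1) := by exact_mod_cast h
    have hd : (d + 1 : ℚ) ≠ 0 := by positivity
    refine mul_eq_zero_of_right _ ?_
    rw [← add_assoc]
    apply mul_left_cancel₀ hd
    push_cast at h'
    linear_combination -h'

lemma card_formula (m p : ℕ) : ((p : ℚ) + 1) * ((Int m 0 (p + 1)).card : ℚ) =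
    coeff p (wi ^ (m * (m + 2) * (p + 1) + m + 2 + 1) * (1 - C (((m : ℚ) + 1) ^ 2) * X)) := by
  set e := m * (m + 2) with he
  have hb : IsUnit (1 + C (X : ℚ⟦X⟧) * X : ℚ⟦X⟧⟦X⟧) := by
    rw [PowerSeries.isUnit_iff_constantCoeff]; simp
  obtain ⟨b, hb⟩ := hb.exists_right_inv
  have hu : IsUnit (1 - ((m : ℚ⟦X⟧) + 1) * X) := by
    rw [PowerSeries.isUnit_iff_constantCoeff]; simp
  have h0 : wi ^ (m + 2) * (1 - X) ^ (m + 2) = 1 := by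
    simpa using wi_one_sub 0 (m + 2)
  have hT : X * (1 - X) ^ e * (wi ^ (m + 2)) ^ (m + 1) = X * wi ^ (m + 2) := by
    rw [← pow_mul, ← wi_one_sub (m + 2) e, show (m + 2) * (m + 1) = m + 2 + e by rw [he]; ring]
    ring
  have key := congr_main m (p + 2) (X : ℚ⟦X⟧) (wi ^ (m + 2)) (X * (1 - X) ^ e) ((1 - X) ^ e) b hb h0 hT
    rfl hu
  obtain ⟨E, hE⟩ := key
  have hd := congrArg (fun K => coeff p (derivative ℚ K * wi ^ (e * (p + 1)))) hE
  have hr : coeff p (derivative ℚ (X ^ (p + 2) * E) * wi ^ (e * (p + 1))) = 0 := by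
    have : derivative ℚ (X ^ (p + 2) * E) * wi ^ (e * (p + 1)) =
      X ^ (p + 1) * ((X * derivative ℚ E + ((p : ℚ⟦X⟧) + 2) * E) * wi ^ (e * (p + 1))) := by
      rw [Derivation.leibniz, derivative_pow]
      simp only [smul_eq_mul, derivative_X, Nat.add_sub_cancel]
      rw [show p + 2 - 1 = p + 1 by omega]
      push_cast; ring
    rw [this]
    exact PowerSeries.X_pow_dvd_iff.1 (dvd_mul_right _ _) p (by omega)
  rw [hr, map_sub, sub_mul, map_sub, sub_eq_zero] at hd
  have hl : coeff p (derivative ℚ (∑ n ∈ Finset.range (p + 2), (X * (1 - X) ^ e) ^ n *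
      ((Int m 0 n).card : ℚ⟦X⟧)) * wi ^ (e * (p + 1))) =
      ((p : ℚ) + 1) * ((Int m 0 (p + 1)).card : ℚ) := by
    have h1 : ∀ n, derivative ℚ ((X * (1 - X) ^ e) ^ n * ((Int m 0 n).card : ℚ⟦X⟧))
        * wi ^ (e * (p + 1)) =
        C ((Int m 0 n).card : ℚ) * (derivative ℚ ((X * (1 - X) ^ e) ^ n) * wi ^ (e * (p + 1))) := by
      intro n
      rw [Derivation.leibniz]
      simp
      ring
    rw [map_sum, Finset.sum_mul, map_sum]
    simp_rw [h1, coeff_C_mul]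
    rw [Finset.sum_range_succ', Finset.sum_range_succ, lag_pow e p 0 p (by omega)]
    rw [Finset.sum_eq_zero]
    · simp [mul_comm]
    · intro j hj
      have hj' := Finset.mem_range.1 hj
      rw [lag_pow e p (p - j) j (by omega), if_neg (by omega), mul_zero]
  rw [hl] at hd
  rw [hd]
  congr 1
  rw [Derivation.leibniz, der_wi_pow]
  have h2 : derivative ℚ (1 - ((m : ℚ⟦X⟧) + 1) * X) = -((m : ℚ⟦X⟧) + 1) := by
    rw [map_sub, Derivation.leibniz]; simp
  rw [h2]
  simp only [smul_eq_mul, map_pow, map_add, map_natCast, map_one]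
  have e1 : wi ^ (e * (p + 1) + m + 2 + 1) = wi ^ (e * (p + 1)) * wi ^ (m + 2) * wi := by
    rw [← pow_add, ← pow_succ]; congr 1
  rw [e1]
  push_cast
  linear_combination (((m : ℚ⟦X⟧) + 1) * wi ^ (m + 2) * wi ^ (e * (p + 1))) * wi_mul

lemma final_count (m p : ℕ) : ((Int m 0 (p + 1)).card : ℚ) =
    ((m + 1 : ℚ) / (((p + 1 : ℕ) : ℚ) * (m * ((p + 1 : ℕ) : ℚ) + 1))) *
        (Nat.choose ((m + 1) ^ 2 * (p + 1) + m) p : ℚ) := by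
  have h := card_formula m p
  have hp : (p : ℚ) + 1 ≠ 0 := by positivity
  have hmp : (m : ℚ) * (p + 1) + 1 ≠ 0 := by positivity
  push_cast
  rw [div_mul_eq_mul_div, eq_div_iff (mul_ne_zero hp hmp)]
  rcases p with _ | p
  · simp [wi] at h
    simp [h]
  · rw [coeff_lin, coeff_wi, coeff_wi] at h
    set L := (m + 1) ^ 2 * (p + 1 + 1) + m with hL
    have e1 : m * (m + 2) * (p + 1 + 1) + m + 2 + (p + 1) = L + 1 := by rw [hL]; ring
    have e2 : m * (m + 2) * (p + 1 + 1) + m + 2 + p = L := by rw [hL]; ring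
    rw [e1, e2] at h
    -- choose (L+1) (p+1) = choose L p + choose L (p+1)
    have c1 : (Nat.choose (L + 1) (p + 1) : ℚ) = Nat.choose L p + Nat.choose L (p + 1) := by
      exact_mod_cast Nat.choose_succ_succ L p
    have c2 := Nat.choose_succ_right_eq L p
    have hle : p ≤ L := by rw [← e2]; omega
    have c3 : (Nat.choose L (p + 1) : ℚ) * (p + 1) =
        Nat.choose L p * (m * (m + 2) * (p + 1 + 1) + m + 2) := by
      have : L - p = m * (m + 2) * (p + 1 + 1) + m + 2 := by omega
      rw [this] at c2
      exact_mod_cast c2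
    rw [c1] at h
    push_cast at h ⊢
    have hm2 : (m : ℚ) + 2 ≠ 0 := by positivity
    have hp1 : (p : ℚ) + 1 ≠ 0 := by positivity
    linear_combination ((m : ℚ) * (p + 2) + 1) * h + (m : ℚ) * c3

end lagrange

end TamariCount

/-- For `m ≥ 1` and `n ≥ 1`, the number of intervals of the ordinary
`m`-Tamari poset on `D_{m,n}` equals
`(m+1)/(n(mn+1)) · binom((m+1)²n + m, n−1)`. -/
theorem ordinary_interval_count (m n : ℕ) (hm : 1 ≤ m) (hn : 1 ≤ n) :
    (Nat.card {p : List Bool × List Bool //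
        IsDyck m p.1 ∧ p.1.count true = n ∧
        IsDyck m p.2 ∧ p.2.count true = n ∧
        OrdLe m p.1 p.2} : ℚ) =
      ((m + 1 : ℚ) / (n * (m * n + 1))) *
        (Nat.choose ((m + 1) ^ 2 * n + m) (n - 1) : ℚ) := by
  obtain ⟨p, rfl⟩ : ∃ p, n = p + 1 := ⟨n - 1, by omega⟩
  have hcard : Nat.card {q : List Bool × List Bool //
        IsDyck m q.1 ∧ q.1.count true = p + 1 ∧
        IsDyck m q.2 ∧ q.2.count true = p + 1 ∧
        OrdLe m q.1 q.2} = (TamariCount.Int m 0 (p + 1)).card := by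
    refine Nat.subtype_card _ ?_
    rintro ⟨a, b⟩
    rw [TamariCount.mem_Int, TamariCount.isDyck_iff, TamariCount.isDyck_iff]
    unfold TamariCount.Wd TamariCount.Dy
    simp only [Nat.cast_zero, neg_zero]
    tauto
  rw [hcard, TamariCount.final_count m p]
  simp
end
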